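/- arXiv:2506.00897 — 13 statements merged into one kernel-verified Lean document; each statement's English description precedes it below -/
import Mathlib

section
/- The subspace f is a complex Lie subalgebra of g: for all x, y ∈ f one has B(x,y) ∈ f. -/
open Complex Matrix LieAlgebra.SpecialLinear

noncomputable section

/-- Index set `{h : ℤ | -k ≤ h ≤ k}`. -/
abbrev Idx (k : ℕ) := {h : ℤ // -(k : ℤ) ≤ h ∧ h ≤ (k : ℤ)}

/-- `V = ℂ^{2k+1}` with coordinates indexed by `Idx k`. -/
abbrev Vc (k : ℕ) := Idx k → ℂ

/-- Extension by zero of a vector `v : Vc k` to all of `ℤ`. -/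
def extV (k : ℕ) (v : Vc k) (h : ℤ) : ℂ :=
  if hc : -(k : ℤ) ≤ h ∧ h ≤ (k : ℤ) then v ⟨h, hc⟩ else 0

lemma extV_add (k : ℕ) (v w : Vc k) (h : ℤ) :
    extV k (v + w) h = extV k v h + extV k w h := by
  unfold extV; split <;> simp

lemma extV_smul (k : ℕ) (c : ℂ) (v : Vc k) (h : ℤ) :
    extV k (c • v) h = c * extV k v h := by
  unfold extV; split <;> simp

/-- `ρH (v_h) = 2h v_h`. -/
def rhoH (k : ℕ) : Vc k →ₗ[ℂ] Vc k where
  toFun v j := (2 * (j.1 : ℂ)) * v j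
  map_add' v w := by funext j; simp [mul_add]
  map_smul' c v := by funext j; simp; ring

/-- `ρ↑ (v_h) = (k-h) v_{h+1}`. -/
def rhoU (k : ℕ) : Vc k →ₗ[ℂ] Vc k where
  toFun v j := ((k : ℂ) - (j.1 : ℂ) + 1) * extV k v (j.1 - 1)
  map_add' v w := by funext j; simp [extV_add, mul_add]
  map_smul' c v := by funext j; simp [extV_smul]; ring

/-- `ρ↓ (v_h) = (k+h) v_{h-1}`. -/
def rhoD (k : ℕ) : Vc k →ₗ[ℂ] Vc k where
  toFun v j := ((k : ℂ) + (j.1 : ℂ) + 1) * extV k v (j.1 + 1)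
  map_add' v w := by funext j; simp [extV_add, mul_add]
  map_smul' c v := by funext j; simp [extV_smul]; ring

/-- `sl(2,ℂ)`: the Lie algebra of 2×2 traceless complex matrices. -/
abbrev sl2 := sl (Fin 2) ℂ

lemma mem_sl2 (M : Matrix (Fin 2) (Fin 2) ℂ) (h : Matrix.trace M = 0) : M ∈ sl2 := by
  show M ∈ LinearMap.ker (Matrix.traceLinearMap (Fin 2) ℂ ℂ)
  simpa [LinearMap.mem_ker] using h

/-- The matrix `H`. -/
def Hs : sl2 := ⟨!![1, 0; 0, -1], mem_sl2 _ (by simp [Matrix.trace_fin_two])⟩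
/-- The matrix `X↑`. -/
def XUs : sl2 := ⟨!![0, 1; 0, 0], mem_sl2 _ (by simp [Matrix.trace_fin_two])⟩
/-- The matrix `X↓`. -/
def XDs : sl2 := ⟨!![0, 0; 1, 0], mem_sl2 _ (by simp [Matrix.trace_fin_two])⟩

/-- For `X = [[a,b],[c,-a]] ∈ sl(2,ℂ)`, `ρ(X) = a ρH + b ρ↑ + c ρ↓`. -/
def rhoS (k : ℕ) (X : sl2) : Vc k →ₗ[ℂ] Vc k :=
  (X : Matrix (Fin 2) (Fin 2) ℂ) 0 0 • rhoH k +
    (X : Matrix (Fin 2) (Fin 2) ℂ) 0 1 • rhoU k +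
    (X : Matrix (Fin 2) (Fin 2) ℂ) 1 0 • rhoD k

/-- `g = sl(2,ℂ) × V`. -/
abbrev gl (k : ℕ) := sl2 × Vc k

/-- The bracket `B((X,v),(Y,w)) = (XY - YX, ρ(X)w - ρ(Y)v)` on `g`. -/
def B (k : ℕ) (x y : gl k) : gl k :=
  (⁅x.1, y.1⁆, rhoS k x.1 y.2 - rhoS k y.1 x.2)

/-- The basis vector `v_h` of `V` (extended by `0` if `h` is out of range). -/
def eV (k : ℕ) (h : ℤ) : Vc k := fun j => if j.1 = h then 1 else 0

/-- The generating set of `f`: `{(H,0), (X↑,0)} ∪ {(0,v_h) : 1 ≤ h ≤ k}`. -/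
def fSet (k : ℕ) : Set (gl k) :=
  {((Hs, 0) : gl k), ((XUs, 0) : gl k)} ∪
    {x : gl k | ∃ h : ℤ, 1 ≤ h ∧ h ≤ (k : ℤ) ∧ x = (0, eV k h)}

/-- `f ⊆ g`, the ℂ-linear span of `{(H,0), (X↑,0)} ∪ {(0,v_h) : 1 ≤ h ≤ k}`. -/
def fSub (k : ℕ) : Submodule ℂ (gl k) := Submodule.span ℂ (fSet k)

/-- The conjugation `τ` on `sl(2,ℂ)`, `X ↦ -(conj X)ᵀ`. -/
def tauS (X : sl2) : sl2 :=
  ⟨-((X : Matrix (Fin 2) (Fin 2) ℂ).map (starRingEnd ℂ))ᵀ, mem_sl2 _ (by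
    have hX : (X : Matrix (Fin 2) (Fin 2) ℂ) 0 0 + (X : Matrix (Fin 2) (Fin 2) ℂ) 1 1 = 0 := by
      have := X.2
      have h2 : Matrix.trace (X : Matrix (Fin 2) (Fin 2) ℂ) = 0 := this
      simpa [Matrix.trace_fin_two] using h2
    simp only [Matrix.trace_fin_two, Matrix.transpose_apply, Matrix.neg_apply, Matrix.map_apply]
    rw [neg_add_eq_sub, ← neg_add', ← map_add, add_comm, hX]
    simp)⟩

/-- The conjugation `τ` on `V`: `u_h = (-1)^h conj (v_{-h})`. -/
def tauV (k : ℕ) (v : Vc k) : Vc k := fun j =>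
  (-1 : ℂ) ^ (j.1) * (starRingEnd ℂ) (v ⟨-j.1, by obtain ⟨a, b⟩ := j.2; omega⟩)

/-- The conjugation `τ` on `g = sl(2,ℂ) × V`. -/
def tauG (k : ℕ) (x : gl k) : gl k := (tauS x.1, tauV k x.2)

/-- The index `0 ∈ Idx k`. -/
def zeroIdx (k : ℕ) : Idx k := ⟨0, by omega⟩

end

/-- `f` consists of the pairs `(X, v)` with `X` upper triangular and `v` supported on `h ≥ 1`. -/
lemma mem_fSub_iff (k : ℕ) (x : gl k) :
    x ∈ fSub k ↔ (x.1 : Matrix (Fin 2) (Fin 2) ℂ) 1 0 = 0 ∧ ∀ j : Idx k, j.1 ≤ 0 → x.2 j = 0 := by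
  constructor
  · intro hx
    refine Submodule.span_induction (p := fun x _ =>
      (x.1 : Matrix (Fin 2) (Fin 2) ℂ) 1 0 = 0 ∧ ∀ j : Idx k, j.1 ≤ 0 → x.2 j = 0)
      ?_ (by simp) ?_ ?_ hx
    · rintro x ((rfl | rfl) | ⟨h, h1, -, rfl⟩)
      · simp [Hs]
      · simp [XUs]
      · refine ⟨by simp, fun j hj => ?_⟩
        have : j.1 ≠ h := by omega
        simp [eV, this]
    · rintro x y - - ⟨hx, hx'⟩ ⟨hy, hy'⟩
      exact ⟨by simp [hx, hy], fun j hj => by simp [hx' j hj, hy' j hj]⟩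
    · rintro c x - ⟨hx, hx'⟩
      exact ⟨by simp [hx], fun j hj => by simp [hx' j hj]⟩
  · obtain ⟨X, v⟩ := x
    rintro ⟨hX, hv⟩
    have htr : (X : Matrix (Fin 2) (Fin 2) ℂ) 0 0 + (X : Matrix (Fin 2) (Fin 2) ℂ) 1 1 = 0 := by
      have h : Matrix.trace (X : Matrix (Fin 2) (Fin 2) ℂ) = 0 := X.2
      simpa [Matrix.trace_fin_two] using h
    have : Finite (Idx k) := (Set.finite_Icc (-(k : ℤ)) k).to_subtype
    have := Fintype.ofFinite (Idx k)
    have hdecomp : ((X, v) : gl k) = (X : Matrix (Fin 2) (Fin 2) ℂ) 0 0 • ((Hs, 0) : gl k) +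
        (X : Matrix (Fin 2) (Fin 2) ℂ) 0 1 • ((XUs, 0) : gl k) +
        ∑ j : Idx k, v j • ((0, eV k j.1) : gl k) := by
      refine Prod.ext ?_ ?_
      · apply Subtype.ext
        ext i j
        fin_cases i <;> fin_cases j <;> simp_all [Hs, XUs, Prod.fst_sum]
        linear_combination htr
      · ext i
        simp [Prod.snd_sum, eV, Finset.sum_apply, ← Subtype.ext_iff]
    rw [hdecomp]
    refine add_mem (add_mem (Submodule.smul_mem _ _ ?_) (Submodule.smul_mem _ _ ?_))
      (sum_mem fun j _ => ?_)
    · exact Submodule.subset_span (by simp [fSet])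
    · exact Submodule.subset_span (by simp [fSet])
    · rcases le_or_gt j.1 0 with hj | hj
      · rw [show v j = 0 from hv j hj, zero_smul]
        exact zero_mem _
      · exact Submodule.smul_mem _ _
          (Submodule.subset_span (Or.inr ⟨j.1, hj, j.2.2, rfl⟩))

/-- Upper triangular matrices preserve the vectors supported on `h ≥ 1`. -/
lemma rhoS_apply_eq_zero (k : ℕ) (X : sl2) (v : Vc k)
    (hX : (X : Matrix (Fin 2) (Fin 2) ℂ) 1 0 = 0) (hv : ∀ j : Idx k, j.1 ≤ 0 → v j = 0)
    (j : Idx k) (hj : j.1 ≤ 0) : rhoS k X v j = 0 := by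
  have hext : extV k v (j.1 - 1) = 0 := by
    unfold extV
    split
    · exact hv _ (by simp only; omega)
    · rfl
  simp [rhoS, rhoH, rhoU, hX, hv j hj, hext]

/-- `f` is a complex Lie subalgebra of `g`. -/
theorem stmt3 (k : ℕ) (hk : 1 ≤ k) :
    ∀ x y : gl k, x ∈ fSub k → y ∈ fSub k → B k x y ∈ fSub k := by
  intro x y hx hy
  rw [mem_fSub_iff] at hx hy ⊢
  refine ⟨?_, fun j hj => ?_⟩
  · simp [B, LieSubalgebra.coe_bracket, Ring.lie_def, Matrix.mul_apply, Fin.sum_univ_two, hx.1, hy.1]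
  · simp [B, rhoS_apply_eq_zero k x.1 y.2 hx.1 hy.2 j hj,
      rhoS_apply_eq_zero k y.1 x.2 hy.1 hx.2 j hj]
end

section
/- The map τ is an involutive antilinear automorphism of (g, B), i.e. τ ∘ τ = id, τ is ℝ-linear with τ(c·x) = conj(c)·τ(x) for all c ∈ ℂ and x ∈ g, and τ(B(x,y)) = B(τ(x), τ(y)) for all x, y ∈ g; moreover τ(f) equals the ℂ-linear span of {(H,0), (X↓,0)} ∪ {(0, v_{−h}) : 1 ≤ h ≤ k}. -/
open Complex Matrix LieAlgebra.SpecialLinear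

/-- The generating set of `τ(f)`: `{(H,0), (X↓,0)} ∪ {(0, v_{-h}) : 1 ≤ h ≤ k}`. -/
noncomputable def fSetOpp (k : ℕ) : Set (gl k) :=
  {((Hs, 0) : gl k), ((XDs, 0) : gl k)} ∪
    {x : gl k | ∃ h : ℤ, 1 ≤ h ∧ h ≤ (k : ℤ) ∧ x = (0, eV k (-h))}

lemma coe_tauS (X : sl2) :
    (tauS X : Matrix (Fin 2) (Fin 2) ℂ) = -(X : Matrix (Fin 2) (Fin 2) ℂ)ᴴ := rfl

lemma tauS_tauS (X : sl2) : tauS (tauS X) = X :=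
  Subtype.ext (by simp [coe_tauS])

lemma tauS_add (X Y : sl2) : tauS (X + Y) = tauS X + tauS Y :=
  Subtype.ext (by simp [coe_tauS, add_comm])

lemma tauS_smul (c : ℂ) (X : sl2) : tauS (c • X) = (starRingEnd ℂ) c • tauS X :=
  Subtype.ext (by simp [coe_tauS])

lemma tauS_lie (X Y : sl2) : tauS ⁅X, Y⁆ = ⁅tauS X, tauS Y⁆ :=
  Subtype.ext (by simp [coe_tauS, Ring.lie_def])

lemma inv_neg_one_zpow (h : ℤ) : ((-1 : ℂ) ^ h)⁻¹ = (-1 : ℂ) ^ h := by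
  rw [← _root_.inv_zpow, inv_neg, inv_one]

lemma tauV_tauV (k : ℕ) (v : Vc k) : tauV k (tauV k v) = v := by
  funext j
  have hj : (-1 : ℂ) ^ j.1 ≠ 0 := zpow_ne_zero _ (by norm_num)
  simp [tauV, mul_inv_cancel_left₀ hj]

lemma tauV_add (k : ℕ) (v w : Vc k) : tauV k (v + w) = tauV k v + tauV k w := by
  funext j
  simp [tauV, mul_add]

lemma tauV_smul (k : ℕ) (c : ℂ) (v : Vc k) :
    tauV k (c • v) = (starRingEnd ℂ) c • tauV k v := by
  funext j
  simp [tauV, mul_left_comm]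

/-- The conjugation `τ` on `V` as a semilinear map. -/
noncomputable def tauVLin (k : ℕ) : Vc k →ₛₗ[starRingEnd ℂ] Vc k where
  toFun := tauV k
  map_add' := tauV_add k
  map_smul' := tauV_smul k

lemma extV_tauV (k : ℕ) (v : Vc k) (h : ℤ) :
    extV k (tauV k v) h = (-1 : ℂ) ^ h * (starRingEnd ℂ) (extV k v (-h)) := by
  by_cases hh : -(k : ℤ) ≤ h ∧ h ≤ (k : ℤ)
  · have hneg : -(k : ℤ) ≤ -h ∧ -h ≤ (k : ℤ) := by omega
    simp only [extV, dif_pos hh, dif_pos hneg, tauV]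
  · have hneg : ¬(-(k : ℤ) ≤ -h ∧ -h ≤ (k : ℤ)) := by omega
    simp only [extV, dif_neg hh, dif_neg hneg, map_zero, mul_zero]

lemma tauV_rhoH (k : ℕ) (v : Vc k) : tauV k (rhoH k v) = -rhoH k (tauV k v) := by
  funext j
  simp [tauV, rhoH, Complex.conj_ofNat]
  ring

lemma tauV_rhoU (k : ℕ) (v : Vc k) : tauV k (rhoU k v) = -rhoD k (tauV k v) := by
  funext j
  simp only [tauV, rhoU, rhoD, LinearMap.coe_mk, AddHom.coe_mk, Pi.neg_apply, extV_tauV]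
  rw [zpow_add_one₀ (by norm_num), neg_add']
  simp
  ring

lemma tauV_rhoD (k : ℕ) (v : Vc k) : tauV k (rhoD k v) = -rhoU k (tauV k v) := by
  funext j
  simp only [tauV, rhoU, rhoD, LinearMap.coe_mk, AddHom.coe_mk, Pi.neg_apply, extV_tauV]
  rw [zpow_sub_one₀ (by norm_num), neg_sub', sub_neg_eq_add]
  simp
  ring

lemma tauV_rhoS (k : ℕ) (X : sl2) (v : Vc k) :
    tauV k (rhoS k X v) = rhoS k (tauS X) (tauV k v) := by
  simp [rhoS, tauV_add, tauV_smul, tauV_rhoH, tauV_rhoU, tauV_rhoD, coe_tauS]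
  abel

/-- The conjugation `τ` on `g` as a semilinear map. -/
noncomputable def tauGLin (k : ℕ) : gl k →ₛₗ[starRingEnd ℂ] gl k where
  toFun := tauG k
  map_add' _ _ := Prod.ext (tauS_add _ _) (tauV_add k _ _)
  map_smul' c _ := Prod.ext (tauS_smul c _) (tauV_smul k c _)

lemma tauG_tauG (k : ℕ) (x : gl k) : tauG k (tauG k x) = x :=
  Prod.ext (tauS_tauS _) (tauV_tauV k _)

lemma tauG_B (k : ℕ) (x y : gl k) : tauG k (B k x y) = B k (tauG k x) (tauG k y) := by
  refine Prod.ext (tauS_lie _ _) ?_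
  change tauVLin k (rhoS k x.1 y.2 - rhoS k y.1 x.2) = _
  rw [map_sub]
  exact congrArg₂ (· - ·) (tauV_rhoS k _ _) (tauV_rhoS k _ _)

lemma tauS_Hs : tauS Hs = -Hs :=
  Subtype.ext (by ext i j; fin_cases i <;> fin_cases j <;> simp [coe_tauS, Hs])

lemma tauS_XUs : tauS XUs = -XDs :=
  Subtype.ext (by ext i j; fin_cases i <;> fin_cases j <;> simp [coe_tauS, XUs, XDs])

lemma tauS_XDs : tauS XDs = -XUs := by
  rw [← tauS_tauS (-XUs), ← neg_one_smul ℂ XUs, tauS_smul, tauS_XUs]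
  simp

lemma tauV_eV (k : ℕ) (h : ℤ) : tauV k (eV k h) = (-1 : ℂ) ^ h • eV k (-h) := by
  funext j
  by_cases hj : j.1 = -h
  · simp [tauV, eV, hj, inv_neg_one_zpow]
  · simp [tauV, eV, hj, neg_eq_iff_eq_neg]

lemma tauG_Hs (k : ℕ) : tauG k (Hs, 0) = -(Hs, 0) :=
  Prod.ext tauS_Hs (map_zero (tauVLin k) |>.trans neg_zero.symm)

lemma tauG_XUs (k : ℕ) : tauG k (XUs, 0) = -(XDs, 0) :=
  Prod.ext tauS_XUs (map_zero (tauVLin k) |>.trans neg_zero.symm)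

lemma tauG_XDs (k : ℕ) : tauG k (XDs, 0) = -(XUs, 0) :=
  Prod.ext tauS_XDs (map_zero (tauVLin k) |>.trans neg_zero.symm)

lemma tauG_eV (k : ℕ) (h : ℤ) :
    tauG k (0, eV k h) = (-1 : ℂ) ^ h • (0, eV k (-h)) :=
  Prod.ext (by simp [tauG, Subtype.ext_iff, coe_tauS]) (tauV_eV k h)

lemma tauG_mem_span_fSetOpp {k : ℕ} {x : gl k} (hx : x ∈ fSub k) :
    tauG k x ∈ Submodule.span ℂ (fSetOpp k) := by
  suffices fSub k ≤ (Submodule.span ℂ (fSetOpp k)).comap (tauGLin k) from this hx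
  refine Submodule.span_le.2 ?_
  rintro _ ((rfl | rfl) | ⟨h, h1, hk, rfl⟩) <;> change tauG k _ ∈ Submodule.span ℂ _
  · rw [tauG_Hs]
    exact neg_mem (Submodule.subset_span (.inl (.inl rfl)))
  · rw [tauG_XUs]
    exact neg_mem (Submodule.subset_span (.inl (.inr rfl)))
  · rw [tauG_eV]
    exact Submodule.smul_mem _ _ (Submodule.subset_span (.inr ⟨h, h1, hk, rfl⟩))

lemma tauG_mem_fSub {k : ℕ} {x : gl k} (hx : x ∈ Submodule.span ℂ (fSetOpp k)) :
    tauG k x ∈ fSub k := by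
  suffices Submodule.span ℂ (fSetOpp k) ≤ (fSub k).comap (tauGLin k) from this hx
  refine Submodule.span_le.2 ?_
  rintro _ ((rfl | rfl) | ⟨h, h1, hk, rfl⟩) <;> change tauG k _ ∈ Submodule.span ℂ (fSet k)
  · rw [tauG_Hs]
    exact neg_mem (Submodule.subset_span (.inl (.inl rfl)))
  · rw [tauG_XDs]
    exact neg_mem (Submodule.subset_span (.inl (.inr rfl)))
  · rw [tauG_eV, neg_neg]
    exact Submodule.smul_mem _ _ (Submodule.subset_span (.inr ⟨h, h1, hk, rfl⟩))

/-- `τ` is an involutive antilinear automorphism of `(g, B)`, and `τ(f)` is the span of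
`{(H,0), (X↓,0)} ∪ {(0, v_{-h}) : 1 ≤ h ≤ k}`. -/
theorem stmt4 (k : ℕ) (hk : 1 ≤ k) :
    (∀ x : gl k, tauG k (tauG k x) = x) ∧
    (∀ x y : gl k, tauG k (x + y) = tauG k x + tauG k y) ∧
    (∀ (c : ℂ) (x : gl k), tauG k (c • x) = (starRingEnd ℂ) c • tauG k x) ∧
    (∀ x y : gl k, tauG k (B k x y) = B k (tauG k x) (tauG k y)) ∧
    tauG k '' (fSub k : Set (gl k)) = (Submodule.span ℂ (fSetOpp k) : Set (gl k)) := by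
  refine ⟨tauG_tauG k, map_add (tauGLin k), map_smulₛₗ (tauGLin k), tauG_B k, ?_⟩
  refine Set.Subset.antisymm ?_ fun x hx => ⟨tauG k x, tauG_mem_fSub hx, tauG_tauG k x⟩
  rintro _ ⟨x, hx, rfl⟩
  exact tauG_mem_span_fSetOpp hx
end

section
/- The sum of f and τ(f) is the complex subspace of g consisting of all pairs whose V-component has vanishing 0-th coordinate: f + τ(f) = {(X, v) ∈ g : v_0 = 0}. In particular f + τ(f) has complex codimension 1 in g. -/
open Complex Matrix LieAlgebra.SpecialLinear

/-- Evaluation of the `V`-component at the `0`-th coordinate, as a linear form on `g`. -/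
noncomputable def phiOf (k : ℕ) : gl k →ₗ[ℂ] ℂ where
  toFun p := p.2 (zeroIdx k)
  map_add' p q := rfl
  map_smul' c p := rfl

lemma sl2_diag_sum (X : sl2) :
    (X : Matrix (Fin 2) (Fin 2) ℂ) 0 0 + (X : Matrix (Fin 2) (Fin 2) ℂ) 1 1 = 0 := by
  have h : Matrix.trace (X : Matrix (Fin 2) (Fin 2) ℂ) = 0 := X.2
  rwa [Matrix.trace_fin_two] at h

/-- Every element of `g` whose `0`-th coordinate vanishes lies in `f + τ(f)`. -/
lemma exists_eq_add_tauG (k : ℕ) (p : gl k) (hp : p.2 (zeroIdx k) = 0) :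
    ∃ a ∈ fSub k, ∃ b ∈ fSub k, p = a + tauG k b := by
  obtain ⟨X, v⟩ := p
  refine ⟨((X : Matrix (Fin 2) (Fin 2) ℂ) 0 0 • Hs + (X : Matrix (Fin 2) (Fin 2) ℂ) 0 1 • XUs,
      fun j => if j.1 ≤ 0 then 0 else v j), ?_,
    ((-(starRingEnd ℂ) ((X : Matrix (Fin 2) (Fin 2) ℂ) 1 0)) • XUs,
      fun j => if j.1 ≤ 0 then 0 else tauV k v j), ?_, ?_⟩
  · rw [mem_fSub_iff]
    exact ⟨by simp [Hs, XUs], fun j hj => if_pos hj⟩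
  · rw [mem_fSub_iff]
    exact ⟨by simp [XUs], fun j hj => if_pos hj⟩
  · refine Prod.ext ?_ ?_
    · ext i j
      fin_cases i <;> fin_cases j <;> simp [Hs, XUs, tauG, tauS]
      linear_combination sl2_diag_sum X
    · funext j
      rcases lt_trichotomy j.1 0 with hj | hj | hj
      · have hj' : ¬ (-j.1 ≤ 0) := by omega
        have hsign : (-1 : ℂ) ^ j.1 * (-1 : ℂ) ^ (-j.1) = 1 := by
          rw [← zpow_add₀ (by norm_num)]; simp
        simp only [tauG, tauV, Prod.snd_add, Pi.add_apply, if_pos hj.le, if_neg hj', map_mul,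
          map_zpow₀, map_neg, map_one, Complex.conj_conj, neg_neg, zero_add, ← mul_assoc, hsign,
          one_mul]
      · obtain rfl : j = zeroIdx k := Subtype.ext hj
        simpa [tauG, tauV, zeroIdx] using hp
      · have hj' : -j.1 ≤ 0 := by omega
        simp [tauG, tauV, hj', not_le.mpr hj]

/-- `f + τ(f) = {(X,v) ∈ g : v₀ = 0}`, a subspace of complex codimension 1 in `g`. -/
theorem stmt5 (k : ℕ) (hk : 1 ≤ k) :
    {x : gl k | ∃ a ∈ fSub k, ∃ b ∈ fSub k, x = a + tauG k b}
      = {p : gl k | p.2 (zeroIdx k) = 0} ∧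
    Module.finrank ℂ (gl k ⧸ LinearMap.ker (phiOf k)) = 1 := by
  refine ⟨Set.ext fun x => ⟨?_, exists_eq_add_tauG k x⟩, ?_⟩
  · rintro ⟨a, ha, b, hb, rfl⟩
    have ha0 := ((mem_fSub_iff k a).1 ha).2 (zeroIdx k) le_rfl
    have hb0 := ((mem_fSub_iff k b).1 hb).2 (zeroIdx k) le_rfl
    simp only [zeroIdx] at ha0 hb0
    simp [tauG, tauV, zeroIdx, ha0, hb0]
  · have hsurj : Function.Surjective (phiOf k) := fun c => ⟨(0, fun _ => c), rfl⟩
    rw [((phiOf k).quotKerEquivOfSurjective hsurj).finrank_eq, Module.finrank_self]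
end

section
/- The isotropy of the CR algebra is one-dimensional: the set of τ-fixed elements of f, {x ∈ f : τ(x) = x}, equals the ℝ-linear span of (i·H, 0); and f ∩ τ(f) equals the ℂ-linear span of (H, 0). -/
open Complex Matrix LieAlgebra.SpecialLinear

/-- The matrix `i·H`. -/
noncomputable def iHs : sl2 :=
  ⟨!![Complex.I, 0; 0, -Complex.I], mem_sl2 _ (by simp [Matrix.trace_fin_two])⟩

lemma sl2_one_one (X : sl2) : X.1 1 1 = -X.1 0 0 := by
  have h : Matrix.trace X.1 = 0 := X.2
  rw [Matrix.trace_fin_two] at h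
  linear_combination h

/-- Two elements of `sl(2,ℂ)` agree if their upper-left and off-diagonal entries agree. -/
lemma sl2_ext {X Y : sl2} (h00 : X.1 0 0 = Y.1 0 0) (h01 : X.1 0 1 = Y.1 0 1)
    (h10 : X.1 1 0 = Y.1 1 0) : X = Y := by
  apply Subtype.ext
  ext i j
  fin_cases i <;> fin_cases j
  · exact h00
  · exact h01
  · exact h10
  · exact (sl2_one_one X).trans (by rw [h00]; exact (sl2_one_one Y).symm)

/-- Elements of `f` are upper triangular in `sl(2,ℂ)` and supported on positive weights in `V`. -/
lemma vanishing_of_mem_fSub {k : ℕ} {x : gl k} (hx : x ∈ fSub k) :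
    x.1.1 1 0 = 0 ∧ ∀ j : Idx k, j.1 ≤ 0 → x.2 j = 0 := by
  induction hx using Submodule.span_induction with
  | mem x hx =>
    rcases hx with (rfl | rfl) | ⟨h, h1, -, rfl⟩
    · simp [Hs]
    · simp [XUs]
    · refine ⟨by simp, fun j hj => if_neg (by omega)⟩
  | zero => simp
  | add x y _ _ hx hy =>
    refine ⟨?_, fun j hj => ?_⟩
    · simp [hx.1, hy.1]
    · simp [hx.2 j hj, hy.2 j hj]
  | smul c x _ hx =>
    refine ⟨?_, fun j hj => ?_⟩
    · simp [hx.1]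
    · simp [hx.2 j hj]

lemma tauS_apply (X : sl2) (i j : Fin 2) :
    (tauS X).1 i j = -(starRingEnd ℂ) (X.1 j i) := rfl

/-- An element of `f` which is the `τ`-image of an element of `f` is a multiple of `H`. -/
lemma eq_smul_Hs_of_mem_of_tauG_mem {k : ℕ} {y : gl k} (hy : y ∈ fSub k)
    (hty : tauG k y ∈ fSub k) : tauG k y = (tauG k y).1.1 0 0 • ((Hs, 0) : gl k) := by
  obtain ⟨hy1, hy2⟩ := vanishing_of_mem_fSub hy
  obtain ⟨ht1, ht2⟩ := vanishing_of_mem_fSub hty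
  refine Prod.ext (sl2_ext ?_ ?_ ?_) ?_
  · simp [Hs]
  · simp [Hs, tauG, tauS_apply, hy1]
  · simp [Hs, ht1]
  · funext j
    rcases le_total j.1 0 with hj | hj
    · simp [ht2 j hj]
    · simp [tauG, tauV, hy2 ⟨-j.1, by have := j.2; omega⟩ (by simpa using hj)]

lemma smul_Hs_mem_fSub (k : ℕ) (c : ℂ) : c • ((Hs, 0) : gl k) ∈ fSub k :=
  Submodule.smul_mem _ _ (Submodule.subset_span (Or.inl (Or.inl rfl)))

lemma tauG_smul_Hs (k : ℕ) (c : ℂ) :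
    tauG k (c • ((Hs, 0) : gl k)) = (-(starRingEnd ℂ) c) • ((Hs, 0) : gl k) := by
  refine Prod.ext (sl2_ext ?_ ?_ ?_) ?_
  · simp [Hs, tauG, tauS_apply]
  · simp [Hs, tauG, tauS_apply]
  · simp [Hs, tauG, tauS_apply]
  · funext j
    simp [tauG, tauV]

lemma iHs_eq_smul (k : ℕ) : ((iHs, 0) : gl k) = Complex.I • ((Hs, 0) : gl k) := by
  refine Prod.ext (sl2_ext ?_ ?_ ?_) ?_ <;> simp [Hs, iHs]

/-- The `τ`-fixed part of `f` is the ℝ-span of `(iH, 0)`, and `f ∩ τ(f)` is the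
ℂ-span of `(H, 0)`. -/
theorem stmt6 (k : ℕ) (hk : 1 ≤ k) :
    {x : gl k | x ∈ fSub k ∧ tauG k x = x}
      = {x : gl k | ∃ t : ℝ, x = (t : ℂ) • ((iHs, 0) : gl k)} ∧
    (fSub k : Set (gl k)) ∩ (tauG k '' (fSub k : Set (gl k)))
      = (Submodule.span ℂ {((Hs, 0) : gl k)} : Set (gl k)) := by
  constructor
  · ext x
    constructor
    · rintro ⟨hx, hτ⟩
      have hH := eq_smul_Hs_of_mem_of_tauG_mem hx (hτ.symm ▸ hx)
      rw [hτ] at hH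
      have h00 : -(starRingEnd ℂ) (x.1.1 0 0) = x.1.1 0 0 :=
        congrArg (fun z : gl k => z.1.1 0 0) hτ
      have hre : (x.1.1 0 0).re = 0 := by
        have := congrArg Complex.re h00
        simp only [Complex.neg_re, Complex.conj_re] at this
        linarith
      refine ⟨(x.1.1 0 0).im, ?_⟩
      rw [iHs_eq_smul, smul_smul]
      convert hH using 2
      apply Complex.ext <;> simp [hre]
    · rintro ⟨t, rfl⟩
      rw [iHs_eq_smul, smul_smul]
      refine ⟨smul_Hs_mem_fSub k _, ?_⟩
      rw [tauG_smul_Hs]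
      simp
  · ext x
    simp only [SetLike.mem_coe, Set.mem_inter_iff, Submodule.mem_span_singleton]
    constructor
    · rintro ⟨hx, y, hy, rfl⟩
      exact ⟨_, (eq_smul_Hs_of_mem_of_tauG_mem hy hx).symm⟩
    · rintro ⟨c, rfl⟩
      refine ⟨smul_Hs_mem_fSub k c, _, smul_Hs_mem_fSub k (-(starRingEnd ℂ) c), ?_⟩
      rw [tauG_smul_Hs]
      simp
end

section
/- The Freeman sequence of the CR algebra stabilizes exactly at step k: defining subspaces F_0 = f and F_{j+1} = {Z ∈ F_j : for all W ∈ f, B(Z, τ(W)) ∈ F_j + τ(f)}, one has, for every j with 1 ≤ j ≤ k, F_j = ℂ-span of {(H,0)} ∪ {(0, v_h) : j+1 ≤ h ≤ k}. In particular F_{k−1} strictly contains F_k, and F_k = f ∩ τ(f) = ℂ-span of (H,0); that is, the CR algebra (g^τ, f) is k-nondegenerate. -/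
open Complex Matrix LieAlgebra.SpecialLinear

/-- The Freeman sequence `F_0 = f`, `F_{j+1} = {Z ∈ F_j : ∀ W ∈ f, B(Z, τW) ∈ F_j + τ(f)}`. -/
noncomputable def Fseq (k : ℕ) : ℕ → Set (gl k)
  | 0 => (fSub k : Set (gl k))
  | (j + 1) => {Z ∈ Fseq k j | ∀ W ∈ (fSub k : Set (gl k)),
      ∃ a ∈ Fseq k j, ∃ b ∈ (fSub k : Set (gl k)), B k Z (tauG k W) = a + tauG k b}

lemma tauV_eq_zero {k : ℕ} {v : Vc k} {i : Idx k}
    (h : ∀ i' : Idx k, i'.1 = -i.1 → v i' = 0) : tauV k v i = 0 := by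
  simp [tauV, h ⟨-i.1, by obtain ⟨a, b⟩ := i.2; omega⟩ rfl]

lemma extV_eq_zero {k : ℕ} {v : Vc k} {h : ℤ} (hv : ∀ i : Idx k, i.1 = h → v i = 0) :
    extV k v h = 0 := by
  unfold extV
  split_ifs with hc
  · exact hv ⟨h, hc⟩ rfl
  · rfl

lemma extV_coe {k : ℕ} (v : Vc k) (i : Idx k) : extV k v i.1 = v i := by
  simp [extV, i.2]

lemma rhoS_apply (k : ℕ) (X : sl2) (v : Vc k) (i : Idx k) :
    rhoS k X v i = X.1 0 0 * (2 * (i.1 : ℂ) * v i) +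
      X.1 0 1 * (((k : ℂ) - (i.1 : ℂ) + 1) * extV k v (i.1 - 1)) +
      X.1 1 0 * (((k : ℂ) + (i.1 : ℂ) + 1) * extV k v (i.1 + 1)) := rfl

lemma bracket_zero_one (X Y : sl2) :
    (⁅X, Y⁆ : sl2).1 0 1 = 2 * (X.1 0 0 * Y.1 0 1 - X.1 0 1 * Y.1 0 0) := by
  have h : (⁅X, Y⁆ : sl2).1 = X.1 * Y.1 - Y.1 * X.1 := rfl
  rw [h]
  simp [Matrix.mul_apply, Fin.sum_univ_two, sl2_one_one]
  ring

/-- A vector vanishing in the coordinates `≤ m` lies in any subspace containing the `(0, v_h)`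
with `m < h ≤ k`. -/
lemma inr_mem_of_eV_mem {k : ℕ} {m : ℤ} {S : Submodule ℂ (gl k)}
    (hS : ∀ h : ℤ, m + 1 ≤ h → h ≤ k → ((0, eV k h) : gl k) ∈ S)
    {v : Vc k} (hv : ∀ i : Idx k, i.1 ≤ m → v i = 0) : ((0, v) : gl k) ∈ S := by
  classical
  have : Finite (Idx k) := (Set.finite_Icc (-(k : ℤ)) k).to_subtype
  have := Fintype.ofFinite (Idx k)
  have hsum : v = ∑ i : Idx k, v i • eV k i.1 := by
    funext i
    simp [eV, Finset.sum_apply, Subtype.coe_inj]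
  have hmem : v ∈ S.comap (LinearMap.inr ℂ sl2 (Vc k)) := by
    rw [hsum]
    refine Submodule.sum_mem _ fun i _ => ?_
    by_cases hi : i.1 ≤ m
    · simp [hv i hi]
    · exact Submodule.smul_mem _ _ (hS i.1 (by omega) i.2.2)
  exact hmem

/-- The coordinate description of the Freeman sequence. -/
def freemanCoord (k j : ℕ) : Submodule ℂ (gl k) where
  carrier := {x | x.1.1 1 0 = 0 ∧ (1 ≤ j → x.1.1 0 1 = 0) ∧ ∀ i : Idx k, i.1 ≤ j → x.2 i = 0}
  zero_mem' := by simp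
  add_mem' {x y} hx hy := by
    refine ⟨?_, fun h => ?_, fun i hi => ?_⟩
    · simp [hx.1, hy.1]
    · simp [hx.2.1 h, hy.2.1 h]
    · simp [hx.2.2 i hi, hy.2.2 i hi]
  smul_mem' c x hx := by
    refine ⟨?_, fun h => ?_, fun i hi => ?_⟩
    · simp [hx.1]
    · simp [hx.2.1 h]
    · simp [hx.2.2 i hi]

lemma mem_freemanCoord {k j : ℕ} {x : gl k} : x ∈ freemanCoord k j ↔
    x.1.1 1 0 = 0 ∧ (1 ≤ j → x.1.1 0 1 = 0) ∧ ∀ i : Idx k, i.1 ≤ j → x.2 i = 0 := Iff.rfl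

lemma Hs_mem_freemanCoord (k j : ℕ) : ((Hs, 0) : gl k) ∈ freemanCoord k j := by
  simp [mem_freemanCoord, Hs]

lemma eV_mem_freemanCoord {k j : ℕ} {h : ℤ} (hj : (j : ℤ) + 1 ≤ h) :
    ((0, eV k h) : gl k) ∈ freemanCoord k j := by
  refine ⟨rfl, fun _ => rfl, fun i hi => ?_⟩
  simp only [eV]
  exact if_neg (by omega)

lemma XUs_mem_freemanCoord_zero (k : ℕ) : ((XUs, 0) : gl k) ∈ freemanCoord k 0 := by
  simp [mem_freemanCoord, XUs]

lemma fSub_eq (k : ℕ) : fSub k = freemanCoord k 0 := by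
  apply le_antisymm
  · refine Submodule.span_le.2 ?_
    rintro x ((rfl | rfl) | ⟨h, h1, -, rfl⟩)
    · exact Hs_mem_freemanCoord k 0
    · exact XUs_mem_freemanCoord_zero k
    · exact eV_mem_freemanCoord (by simpa using h1)
  · intro x hx
    have hV : ((0, x.2) : gl k) ∈ fSub k :=
      inr_mem_of_eV_mem (m := 0)
        (fun h h1 h2 => Submodule.subset_span (Or.inr ⟨h, by omega, h2, rfl⟩))
        (by simpa using hx.2.2)
    have hH : ((Hs, 0) : gl k) ∈ fSub k := Submodule.subset_span (Or.inl (Or.inl rfl))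
    have hX : ((XUs, 0) : gl k) ∈ fSub k := Submodule.subset_span (Or.inl (Or.inr rfl))
    have hdec : x = x.1.1 0 0 • ((Hs, 0) : gl k) + x.1.1 0 1 • ((XUs, 0) : gl k) + (0, x.2) := by
      refine Prod.ext (sl2_ext ?_ ?_ ?_) ?_
      · simp [Hs, XUs]
      · simp [Hs, XUs]
      · simp [Hs, XUs, hx.1]
      · simp
    rw [hdec]
    exact add_mem (add_mem (Submodule.smul_mem _ _ hH) (Submodule.smul_mem _ _ hX)) hV

lemma span_eq_freemanCoord (k : ℕ) {j : ℕ} (hj : 1 ≤ j) :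
    Submodule.span ℂ (({((Hs, 0) : gl k)} : Set (gl k)) ∪
      {x : gl k | ∃ h : ℤ, (j : ℤ) + 1 ≤ h ∧ h ≤ (k : ℤ) ∧ x = (0, eV k h)}) =
      freemanCoord k j := by
  apply le_antisymm
  · refine Submodule.span_le.2 ?_
    rintro x (rfl | ⟨h, h1, -, rfl⟩)
    · exact Hs_mem_freemanCoord k j
    · exact eV_mem_freemanCoord h1
  · intro x hx
    have hdec : x = x.1.1 0 0 • ((Hs, 0) : gl k) + (0, x.2) := by
      refine Prod.ext (sl2_ext ?_ ?_ ?_) ?_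
      · simp [Hs]
      · simp [Hs, hx.2.1 hj]
      · simp [Hs, hx.1]
      · simp
    rw [hdec]
    refine add_mem (Submodule.smul_mem _ _ (Submodule.subset_span (Or.inl rfl)))
      (inr_mem_of_eV_mem (m := j) (fun h h1 h2 => Submodule.subset_span (Or.inr ⟨h, h1, h2, rfl⟩))
        hx.2.2)

lemma tauG_coords {k : ℕ} {b : gl k} (hb : b ∈ freemanCoord k 0) :
    (tauG k b).1.1 0 1 = 0 ∧ ∀ i : Idx k, 0 ≤ i.1 → (tauG k b).2 i = 0 := by
  refine ⟨?_, fun i hi => tauV_eq_zero fun i' hi' => hb.2.2 i' (by push_cast; omega)⟩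
  simp [tauG, tauS_apply, hb.1]

/-- The coordinate description of `F_j + τ(f)`. -/
lemma exists_add_tauG_iff {k j : ℕ} {u : gl k} :
    (∃ a ∈ freemanCoord k j, ∃ b ∈ freemanCoord k 0, u = a + tauG k b) ↔
      (1 ≤ j → u.1.1 0 1 = 0) ∧ ∀ i : Idx k, 0 ≤ i.1 → i.1 ≤ j → u.2 i = 0 := by
  constructor
  · rintro ⟨a, ha, b, hb, rfl⟩
    obtain ⟨hb1, hb2⟩ := tauG_coords hb
    refine ⟨fun h => ?_, fun i h0 hi => ?_⟩
    · simp [ha.2.1 h, hb1]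
    · simp [ha.2.2 i hi, hb2 i h0]
  · rintro ⟨h1, h2⟩
    refine ⟨(⟨!![u.1.1 0 0, u.1.1 0 1; 0, -u.1.1 0 0], mem_sl2 _ (by simp [trace_fin_two])⟩,
      fun i => if i.1 ≤ j then 0 else u.2 i), ?_,
      tauG k (⟨!![0, 0; u.1.1 1 0, 0], mem_sl2 _ (by simp [trace_fin_two])⟩,
      fun i => if i.1 < 0 then u.2 i else 0), ?_, ?_⟩
    · exact ⟨by simp, fun h => by simpa using h1 h, fun i hi => if_pos hi⟩
    · refine ⟨by simp [tauG, tauS_apply], fun h => by omega, fun i hi => ?_⟩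
      refine tauV_eq_zero fun i' hi' => if_neg ?_
      push_cast at hi
      omega
    · rw [tauG_tauG]
      refine Prod.ext (sl2_ext ?_ ?_ ?_) (funext fun i => ?_)
      · simp
      · simp
      · simp
      · by_cases h0 : i.1 < 0
        · simp [h0, show i.1 ≤ j by omega]
        · by_cases hij : i.1 ≤ j
          · simp [h0, hij, h2 i (by omega) hij]
          · simp [h0, hij]

lemma mem_freemanCoord_succ_iff {k : ℕ} (hk : 1 ≤ k) {j : ℕ} {Z : gl k} :
    Z ∈ freemanCoord k (j + 1) ↔ Z ∈ freemanCoord k j ∧ ∀ W ∈ freemanCoord k 0,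
      ∃ a ∈ freemanCoord k j, ∃ b ∈ freemanCoord k 0, B k Z (tauG k W) = a + tauG k b := by
  simp only [exists_add_tauG_iff]
  constructor
  · rintro ⟨h1, h2, h3⟩
    have h01 := h2 (by omega)
    push_cast at h3
    refine ⟨⟨h1, fun _ => h01, fun i hi => h3 i (by omega)⟩, fun W hW => ?_⟩
    obtain ⟨hW1, hW2⟩ := tauG_coords hW
    refine ⟨fun _ => ?_, fun i h0 hi => ?_⟩
    · simp [B, bracket_zero_one, hW1, h01]
    · simp [B, rhoS_apply, hW1, h01, h1, hW2 i h0, h3 i (by omega),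
        extV_eq_zero (v := Z.2) (h := i.1 + 1) fun i' hi' => h3 i' (by omega)]
  · rintro ⟨⟨h1, h2, h3⟩, hB⟩
    refine ⟨h1, fun _ => ?_, fun i hi => ?_⟩
    · have h := (hB _ (eV_mem_freemanCoord (k := k) (j := 0) (h := 1) (by simp))).2
        (zeroIdx k) le_rfl (by simp [zeroIdx])
      have htau : extV k (tauV k (eV k 1)) (-1) = -1 := by
        simp [extV, tauV, eV, hk]
      have hzero : rhoS k (tauS 0) Z.2 = 0 := by
        have : tauS 0 = 0 := by apply sl2_ext <;> simp [tauS_apply]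
        funext i
        simp [this, rhoS_apply]
      have hk' : -1 + -(k : ℂ) ≠ 0 := by
        rw [← neg_add, neg_ne_zero, add_comm]
        exact Nat.cast_add_one_ne_zero k
      simpa [B, tauG, hzero, rhoS_apply, zeroIdx, htau, h1, hk'] using h
    · rcases (show i.1 ≤ j ∨ i.1 = j + 1 by push_cast at hi; omega) with hi' | hi'
      · exact h3 i hi'
      · have h := (hB _ (XUs_mem_freemanCoord_zero k)).2
          ⟨j, by have := i.2; omega⟩ (by simp) le_rfl
        have htau : tauV k 0 = 0 := funext fun i => tauV_eq_zero fun _ _ => rfl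
        have hkj : (k : ℂ) + j + 1 ≠ 0 := by exact_mod_cast Nat.succ_ne_zero (k + j)
        have hext := extV_coe Z.2 i
        rw [hi'] at hext
        simpa [B, tauG, htau, tauS_apply, rhoS_apply, XUs, hkj, hext] using h

lemma Fseq_eq_freemanCoord {k : ℕ} (hk : 1 ≤ k) (j : ℕ) :
    Fseq k j = (freemanCoord k j : Set (gl k)) := by
  induction j with
  | zero => simp [Fseq, fSub_eq]
  | succ j ih =>
    ext Z
    rw [SetLike.mem_coe, mem_freemanCoord_succ_iff hk]
    simp [Fseq, ih, fSub_eq]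

lemma freemanCoord_self_eq (k : ℕ) (hk : 1 ≤ k) :
    (freemanCoord k k : Set (gl k)) =
      (freemanCoord k 0 : Set (gl k)) ∩ (tauG k '' (freemanCoord k 0 : Set (gl k))) := by
  ext Z
  constructor
  · rintro ⟨h1, h2, h3⟩
    refine ⟨⟨h1, fun h => by omega, fun i _ => h3 i i.2.2⟩, tauG k Z, ?_, tauG_tauG k Z⟩
    refine ⟨by simp [tauG, tauS_apply, h2 hk], fun h => by omega, fun i _ => ?_⟩
    exact tauV_eq_zero fun i' _ => h3 i' i'.2.2
  · rintro ⟨⟨h1, -, h3⟩, W, hW, rfl⟩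
    obtain ⟨hW1, hW2⟩ := tauG_coords hW
    refine ⟨h1, fun _ => hW1, fun i _ => ?_⟩
    rcases le_total i.1 0 with h | h
    · exact h3 i (by simpa using h)
    · exact hW2 i h

/-- The Freeman sequence stabilizes exactly at step `k`:
`F_j = span({(H,0)} ∪ {(0,v_h) : j+1 ≤ h ≤ k})` for `1 ≤ j ≤ k`, `F_{k-1} ⊋ F_k`, and
`F_k = f ∩ τ(f) = ℂ·(H,0)`; i.e. the CR algebra `(g^τ, f)` is `k`-nondegenerate. -/
theorem stmt7 (k : ℕ) (hk : 1 ≤ k) :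
    (∀ j : ℕ, 1 ≤ j → j ≤ k →
      Fseq k j = (Submodule.span ℂ (({((Hs, 0) : gl k)} : Set (gl k)) ∪
        {x : gl k | ∃ h : ℤ, (j : ℤ) + 1 ≤ h ∧ h ≤ (k : ℤ) ∧ x = (0, eV k h)})
          : Set (gl k))) ∧
    Fseq k k ⊂ Fseq k (k - 1) ∧
    Fseq k k = (fSub k : Set (gl k)) ∩ (tauG k '' (fSub k : Set (gl k))) ∧
    Fseq k k = (Submodule.span ℂ ({((Hs, 0) : gl k)} : Set (gl k)) : Set (gl k)) := by
  refine ⟨fun j hj _ => ?_, ?_, ?_, ?_⟩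
  · rw [Fseq_eq_freemanCoord hk, span_eq_freemanCoord k hj]
  · rw [Fseq_eq_freemanCoord hk, Fseq_eq_freemanCoord hk]
    refine ⟨fun Z ⟨h1, h2, h3⟩ => ⟨h1, fun _ => h2 hk, fun i _ => h3 i i.2.2⟩, fun hsub => ?_⟩
    have hmem := hsub (eV_mem_freemanCoord (k := k) (j := k - 1) (h := k) (by omega))
    have h := hmem.2.2 ⟨k, by omega⟩ le_rfl
    simp [eV] at h
  · rw [Fseq_eq_freemanCoord hk, fSub_eq, freemanCoord_self_eq k hk]
  · rw [Fseq_eq_freemanCoord hk, ← span_eq_freemanCoord k hk]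
    congr 2
    refine Set.union_eq_left.2 ?_
    rintro x ⟨h, h1, h2, -⟩
    omega
end

section
/- Every term of the Freeman sequence is a Lie subalgebra: for every j ≥ 0, the submodule f^(j) is closed under the Lie bracket of L, i.e. for all Z₁, Z₂ ∈ f^(j) one has [Z₁, Z₂] ∈ f^(j). -/
/-- Every term of the Freeman sequence `f^(0) = f`,
`f^(j+1) = {Z ∈ f^(j) : ∀ t ∈ T, ⁅Z, t⁆ ∈ f^(j) + T}` is closed under the Lie bracket of `L`. -/
theorem stmt8 (R : Type*) [CommRing R] (L : Type*) [LieRing L] [LieAlgebra R L]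
    (f : LieSubalgebra R L) (T : Submodule R L) (F : ℕ → Submodule R L)
    (hF0 : ∀ Z : L, Z ∈ F 0 ↔ Z ∈ f)
    (hFs : ∀ (j : ℕ) (Z : L), Z ∈ F (j + 1) ↔ Z ∈ F j ∧ ∀ t ∈ T, ⁅Z, t⁆ ∈ F j ⊔ T) :
    ∀ (j : ℕ) (Z₁ Z₂ : L), Z₁ ∈ F j → Z₂ ∈ F j → ⁅Z₁, Z₂⁆ ∈ F j := by
  intro j
  induction j with
  | zero =>
    intro Z₁ Z₂ h₁ h₂
    rw [hF0] at *
    exact f.lie_mem h₁ h₂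
  | succ j ih =>
    have lie_mem_sup : ∀ Z ∈ F (j + 1), ∀ x ∈ F j ⊔ T, ⁅Z, x⁆ ∈ F j ⊔ T := by
      intro Z hZ x hx
      obtain ⟨hZj, hZT⟩ := (hFs j Z).1 hZ
      obtain ⟨w, hw, s, hs, rfl⟩ := Submodule.mem_sup.1 hx
      rw [lie_add]
      exact add_mem (Submodule.mem_sup_left (ih Z w hZj hw)) (hZT s hs)
    intro Z₁ Z₂ h₁ h₂
    obtain ⟨h₁j, h₁T⟩ := (hFs j Z₁).1 h₁
    obtain ⟨h₂j, h₂T⟩ := (hFs j Z₂).1 h₂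
    refine (hFs j _).2 ⟨ih Z₁ Z₂ h₁j h₂j, fun t ht => ?_⟩
    rw [lie_lie]
    exact sub_mem (lie_mem_sup Z₁ h₁ _ (h₂T t ht)) (lie_mem_sup Z₂ h₂ _ (h₁T t ht))
end

section
/- The real part of each vector field in the W-family is tangent to M: for every field X among Z_h, Z'_h (1 ≤ h ≤ k), W, A_{h,j}, A'_{h,j} (1 ≤ h < j ≤ k), A'_h (1 ≤ h ≤ k), and every p ∈ E with F(p) = 0, one has (fderiv ℝ F p)(X(p)) = 0. -/
open Complex

noncomputable section

/-- `E = ℂ^{k+2}` with coordinates `(w, z₀, z₁, …, z_k)`: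
index `0` is `w` and index `h+1` is `z_h` for `0 ≤ h ≤ k`. -/
abbrev Ec (k : ℕ) := Fin (k + 2) → ℂ

/-- The defining function `F(p) = Re w - 2 ∑_{h=1}^{k} Re (z₀^h conj z_h)`. -/
def Fdef (k : ℕ) (p : Ec k) : ℝ :=
  (p 0).re - 2 * ∑ h : Fin k, ((p 1) ^ ((h : ℕ) + 1) * (starRingEnd ℂ) (p h.succ.succ)).re

/-- The real part of the vector field `X` is tangent to `M = {F = 0}`. -/
def Tangent (k : ℕ) (X : Ec k → Ec k) : Prop :=
  ∀ p : Ec k, Fdef k p = 0 → fderiv ℝ (Fdef k) p (X p) = 0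

/-- The Lie bracket of vector fields over `ℂ`. -/
def lb (k : ℕ) (X Y : Ec k → Ec k) : Ec k → Ec k :=
  fun p => fderiv ℂ Y p (X p) - fderiv ℂ X p (Y p)

/-- The Lie bracket of vector fields over `ℝ`. -/
def lbR (k : ℕ) (X Y : Ec k → Ec k) : Ec k → Ec k :=
  fun p => fderiv ℝ Y p (X p) - fderiv ℝ X p (Y p)

/-- `Z_h = z₀^h ∂_w + (1/2) ∂_{z_h}`. -/
def Zf (k h : ℕ) : Ec k → Ec k := fun p m =>
  if (m : ℕ) = 0 then (p 1) ^ h else if (m : ℕ) = h + 1 then 1 / 2 else 0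

/-- `Z'_h = -i z₀^h ∂_w + (i/2) ∂_{z_h}`. -/
def Zf' (k h : ℕ) : Ec k → Ec k := fun p m =>
  if (m : ℕ) = 0 then -I * (p 1) ^ h else if (m : ℕ) = h + 1 then I / 2 else 0

/-- `W = i ∂_w`. -/
def Wf (k : ℕ) : Ec k → Ec k := fun _ m => if (m : ℕ) = 0 then I else 0

/-- `A_{h,j} = (1/2) z₀^h ∂_{z_j} - (1/2) z₀^j ∂_{z_h}`. -/
def Af (k h j : ℕ) : Ec k → Ec k := fun p m =>
  if (m : ℕ) = j + 1 then (1 / 2) * (p 1) ^ h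
  else if (m : ℕ) = h + 1 then -(1 / 2) * (p 1) ^ j else 0

/-- `A'_{h,j} = -(i/2) z₀^h ∂_{z_j} - (i/2) z₀^j ∂_{z_h}`. -/
def Af' (k h j : ℕ) : Ec k → Ec k := fun p m =>
  if (m : ℕ) = j + 1 then -(I / 2) * (p 1) ^ h
  else if (m : ℕ) = h + 1 then -(I / 2) * (p 1) ^ j else 0

/-- `A'_h = i z₀^h ∂_{z_h}`. -/
def Ahf (k h : ℕ) : Ec k → Ec k := fun p m =>
  if (m : ℕ) = h + 1 then I * (p 1) ^ h else 0

/-- The `W`-family of `(k+1)²` vector fields. -/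
def WFamily (k : ℕ) : Set (Ec k → Ec k) :=
  {X | (∃ h : ℕ, 1 ≤ h ∧ h ≤ k ∧ X = Zf k h) ∨
       (∃ h : ℕ, 1 ≤ h ∧ h ≤ k ∧ X = Zf' k h) ∨
       X = Wf k ∨
       (∃ h j : ℕ, 1 ≤ h ∧ h < j ∧ j ≤ k ∧ X = Af k h j) ∨
       (∃ h j : ℕ, 1 ≤ h ∧ h < j ∧ j ≤ k ∧ X = Af' k h j) ∨
       (∃ h : ℕ, 1 ≤ h ∧ h ≤ k ∧ X = Ahf k h)}

/-- `𝓔 = (k+1) w ∂_w + z₀ ∂_{z_0} + ∑ (k+1-h) z_h ∂_{z_h}`. -/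
def Ef (k : ℕ) : Ec k → Ec k := fun p m =>
  if (m : ℕ) = 0 then ((k : ℂ) + 1) * p m
  else if (m : ℕ) = 1 then p m
  else ((k + 2 - (m : ℕ) : ℕ) : ℂ) * p m

/-- `𝓙 = -i z₀ ∂_{z_0} - i ∑ h z_h ∂_{z_h}`. -/
def Jf (k : ℕ) : Ec k → Ec k := fun p m =>
  if (m : ℕ) = 0 then 0
  else if (m : ℕ) = 1 then -I * p m
  else -I * (((m : ℕ) - 1 : ℕ) : ℂ) * p m

/-- `𝓚 = -z₀ ∂_{z_0} + ∑ h z_h ∂_{z_h}`. -/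
def Kf (k : ℕ) : Ec k → Ec k := fun p m =>
  if (m : ℕ) = 0 then 0
  else if (m : ℕ) = 1 then -p m
  else (((m : ℕ) - 1 : ℕ) : ℂ) * p m

/-- `𝓗 = 2k w ∂_w + 2 z₀ ∂_{z_0} + ∑ 2(k-h) z_h ∂_{z_h}`. -/
def Hf (k : ℕ) : Ec k → Ec k := fun p m =>
  if (m : ℕ) = 0 then 2 * (k : ℂ) * p m
  else if (m : ℕ) = 1 then 2 * p m
  else ((2 * (k + 1 - (m : ℕ)) : ℕ) : ℂ) * p m

/-- `Z₋`. -/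
def Zmf (k : ℕ) : Ec k → Ec k := fun p m =>
  if (m : ℕ) = 0 then 2 * (k : ℂ) * p 2
  else if (m : ℕ) = 1 then (k : ℂ)
  else if hm : (m : ℕ) ≤ k then
    -(k : ℂ) * ((m : ℕ) : ℂ) * p ⟨(m : ℕ) + 1, by omega⟩
  else 0

/-- `Z'₋`. -/
def Zmf' (k : ℕ) : Ec k → Ec k := fun p m =>
  if (m : ℕ) = 0 then -2 * I * (k : ℂ) * p 2
  else if (m : ℕ) = 1 then I * (k : ℂ)
  else if hm : (m : ℕ) ≤ k then
    I * (k : ℂ) * ((m : ℕ) : ℂ) * p ⟨(m : ℕ) + 1, by omega⟩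
  else 0

/-- `Z₊`. -/
def Zpf (k : ℕ) : Ec k → Ec k := fun p m =>
  if (m : ℕ) = 0 then p 1 * p 0
  else if (m : ℕ) = 1 then (p 1) ^ 2 / (k : ℂ)
  else if (m : ℕ) = 2 then p 2 * p 1 - p 0 / 2
  else p m * p 1 +
    (1 - (((m : ℕ) - 2 : ℕ) : ℂ) / (k : ℂ)) * p ⟨(m : ℕ) - 1, by have := m.isLt; omega⟩

/-- `Z'₊`. -/
def Zpf' (k : ℕ) : Ec k → Ec k := fun p m =>
  if (m : ℕ) = 0 then -I * p 1 * p 0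
  else if (m : ℕ) = 1 then -I * (p 1) ^ 2 / (k : ℂ)
  else if (m : ℕ) = 2 then -I * p 2 * p 1 - I / 2 * p 0
  else -I * p m * p 1 +
    I * (1 - (((m : ℕ) - 2 : ℕ) : ℂ) / (k : ℂ)) * p ⟨(m : ℕ) - 1, by have := m.isLt; omega⟩

end

theorem differentiable_Fdef (k : ℕ) : Differentiable ℝ (Fdef k) := by
  have hre : Differentiable ℝ Complex.re := Complex.reCLM.differentiable
  have hconj : Differentiable ℝ (starRingEnd ℂ) := Complex.conjCLE.differentiable
  unfold Fdef
  refine (hre.comp (differentiable_apply _)).sub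
    ((Differentiable.fun_sum fun h _ => ?_).const_mul 2)
  exact hre.comp (((differentiable_apply _).pow _).mul (hconj.comp (differentiable_apply _)))

/-- The derivative of `Fdef` in a direction `v` without `∂_{z₀}` component. -/
theorem fderiv_Fdef_apply {k : ℕ} (p v : Ec k) (hv : v 1 = 0) :
    fderiv ℝ (Fdef k) p v = (v 0).re -
      2 * ∑ h : Fin k, ((p 1) ^ ((h : ℕ) + 1) * (starRingEnd ℂ) (v h.succ.succ)).re := by
  set c : ℝ := (v 0).re -
    2 * ∑ h : Fin k, ((p 1) ^ ((h : ℕ) + 1) * (starRingEnd ℂ) (v h.succ.succ)).re with hc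
  have hline : ∀ t : ℝ, Fdef k (p + t • v) = Fdef k p + t * c := by
    intro t
    have hsum : ∑ h : Fin k, ((p 1) ^ ((h : ℕ) + 1) *
          (starRingEnd ℂ) ((p + t • v) h.succ.succ)).re =
        ∑ h : Fin k, ((p 1) ^ ((h : ℕ) + 1) * (starRingEnd ℂ) (p h.succ.succ)).re +
        t * ∑ h : Fin k, ((p 1) ^ ((h : ℕ) + 1) * (starRingEnd ℂ) (v h.succ.succ)).re := by
      rw [Finset.mul_sum, ← Finset.sum_add_distrib]
      refine Finset.sum_congr rfl fun h _ => ?_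
      simp
      ring
    have h1 : (p + t • v) 1 = p 1 := by simp [hv]
    unfold Fdef
    rw [h1, hsum, hc]
    simp
    ring
  have h1 := (differentiable_Fdef k p).lineDeriv_eq_fderiv (v := v)
  rw [← h1, lineDeriv]
  simp only [hline]
  simp

/-- Only the term with index `h` survives in a sum against a multiple of `∂_{z_h}`. -/
theorem sum_re_mul_conj_ite {k h : ℕ} (h1 : 1 ≤ h) (hk : h ≤ k) (z c : ℂ) :
    ∑ i : Fin k, (z ^ ((i : ℕ) + 1) *
      (starRingEnd ℂ) (if (i : ℕ) + 1 = h then c else 0)).re =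
      (z ^ h * (starRingEnd ℂ) c).re := by
  rw [Finset.sum_eq_single (⟨h - 1, by omega⟩ : Fin k)]
  · simp [Nat.sub_add_cancel h1]
  · intro i _ hi
    have : ¬ (i : ℕ) + 1 = h := fun e => hi (Fin.ext (by simp; omega))
    simp [this]
  · simp

theorem sum_re_mul_conj_ite_ite {k h j : ℕ} (h1 : 1 ≤ h) (hj : h < j) (hk : j ≤ k)
    (z c d : ℂ) :
    ∑ i : Fin k, (z ^ ((i : ℕ) + 1) *
      (starRingEnd ℂ) (if (i : ℕ) + 1 = j then c else if (i : ℕ) + 1 = h then d else 0)).re =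
      (z ^ j * (starRingEnd ℂ) c).re + (z ^ h * (starRingEnd ℂ) d).re := by
  rw [← sum_re_mul_conj_ite (h1.trans hj.le) hk z c,
    ← sum_re_mul_conj_ite h1 (hj.le.trans hk) z d, ← Finset.sum_add_distrib]
  refine Finset.sum_congr rfl fun i _ => ?_
  by_cases hij : (i : ℕ) + 1 = j
  · have : ¬ (i : ℕ) + 1 = h := by omega
    simp [hij, hj.ne']
  · simp [hij]

theorem conj_I_div_two : (starRingEnd ℂ) (I / 2) = -(I / 2) := by
  rw [map_div₀, conj_I, map_ofNat, neg_div]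

/-- The real part of each vector field in the `W`-family is tangent to `M`. -/
theorem stmt9 (k : ℕ) (hk : 1 ≤ k) :
    ∀ X ∈ WFamily k, Tangent k X := by
  rintro X (⟨h, h1, h2, rfl⟩ | ⟨h, h1, h2, rfl⟩ | rfl | ⟨h, j, h1, hj, h2, rfl⟩ |
    ⟨h, j, h1, hj, h2, rfl⟩ | ⟨h, h1, h2, rfl⟩) p -
  · have h0 : h ≠ 0 := by omega
    rw [fderiv_Fdef_apply _ _ (by simp [Zf, h0])]
    simp only [Zf, Fin.val_succ, Nat.succ_ne_zero, if_false, Nat.add_right_cancel_iff,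
      sum_re_mul_conj_ite h1 h2]
    simp
    ring
  · have h0 : h ≠ 0 := by omega
    rw [fderiv_Fdef_apply _ _ (by simp [Zf', h0])]
    simp only [Zf', Fin.val_succ, Nat.succ_ne_zero, if_false, Nat.add_right_cancel_iff,
      sum_re_mul_conj_ite h1 h2]
    simp [-map_div₀, conj_I_div_two]
    ring
  · rw [fderiv_Fdef_apply _ _ (by simp [Wf])]
    simp [Wf]
  · have h0 : h ≠ 0 := by omega
    have j0 : j ≠ 0 := by omega
    rw [fderiv_Fdef_apply _ _ (by simp [Af, h0, j0])]
    simp only [Af, Fin.val_succ, Nat.add_right_cancel_iff, sum_re_mul_conj_ite_ite h1 hj h2]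
    simp [-map_pow]
    ring
  · have h0 : h ≠ 0 := by omega
    have j0 : j ≠ 0 := by omega
    rw [fderiv_Fdef_apply _ _ (by simp [Af', h0, j0])]
    simp only [Af', Fin.val_succ, Nat.add_right_cancel_iff, sum_re_mul_conj_ite_ite h1 hj h2]
    simp [-map_pow, -map_div₀, conj_I_div_two]
    ring
  · have h0 : h ≠ 0 := by omega
    rw [fderiv_Fdef_apply _ _ (by simp [Ahf, h0])]
    simp only [Ahf, Fin.val_succ, Nat.add_right_cancel_iff, sum_re_mul_conj_ite h1 h2]
    simp [-map_pow]
    ring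
end

section
/- The W-family is abelian: for any two vector fields X, Y belonging to the W-family (i.e. among Z_h, Z'_h, W, A_{h,j}, A'_{h,j}, A'_h), the Lie bracket over ℂ vanishes identically, [X, Y] = 0. -/
open Complex

/-- The Fréchet derivative vanishes in any direction along which the function is constant. -/
theorem fderiv_apply_eq_zero_of_forall_add_smul_eq {𝕜 E F : Type*} [NontriviallyNormedField 𝕜]
    [NormedAddCommGroup E] [NormedSpace 𝕜 E] [NormedAddCommGroup F] [NormedSpace 𝕜 F]
    {f : E → F} {x v : E} (h : ∀ t : 𝕜, f (x + t • v) = f x) : fderiv 𝕜 f x v = 0 := by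
  by_cases hf : DifferentiableAt 𝕜 f x
  · rw [← hf.lineDeriv_eq_fderiv, lineDeriv]
    simp [h]
  · simp [fderiv_zero_of_not_differentiableAt hf]

/-- Members of the `W`-family have no `∂_{z_0}` component. -/
theorem WFamily.apply_one {k : ℕ} {X : Ec k → Ec k} (hX : X ∈ WFamily k) (p : Ec k) :
    X p 1 = 0 := by
  rcases hX with ⟨h, h1, -, rfl⟩ | ⟨h, h1, -, rfl⟩ | rfl | ⟨h, j, h1, hj, -, rfl⟩ |
    ⟨h, j, h1, hj, -, rfl⟩ | ⟨h, h1, -, rfl⟩ <;>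
  simp only [Zf, Zf', Wf, Af, Af', Ahf, Fin.val_one] <;> grind

/-- The coefficients of members of the `W`-family depend on `z₀` only. -/
theorem WFamily.congr {k : ℕ} {X : Ec k → Ec k} (hX : X ∈ WFamily k) {p q : Ec k}
    (hpq : p 1 = q 1) : X p = X q := by
  rcases hX with ⟨h, -, -, rfl⟩ | ⟨h, -, -, rfl⟩ | rfl | ⟨h, j, -, -, -, rfl⟩ |
    ⟨h, j, -, -, -, rfl⟩ | ⟨h, -, -, rfl⟩ <;>
  ext m <;> simp only [Zf, Zf', Wf, Af, Af', Ahf, hpq]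

theorem WFamily.fderiv_apply_eq_zero {k : ℕ} {X Y : Ec k → Ec k} (hX : X ∈ WFamily k)
    (hY : Y ∈ WFamily k) (p : Ec k) : fderiv ℂ X p (Y p) = 0 :=
  fderiv_apply_eq_zero_of_forall_add_smul_eq fun t =>
    WFamily.congr hX (by simp [WFamily.apply_one hY p])

/-- The `W`-family is abelian: any two of its members commute. -/
theorem stmt10 (k : ℕ) (hk : 1 ≤ k) :
    ∀ X ∈ WFamily k, ∀ Y ∈ WFamily k, lb k X Y = 0 := by
  intro X hX Y hY
  funext p
  simp [lb, WFamily.fderiv_apply_eq_zero hX hY, WFamily.fderiv_apply_eq_zero hY hX]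
end

section
/- The real parts of the vector fields 𝓔, 𝓙, 𝓚 are tangent to M (for every p ∈ E with F(p) = 0, the real derivative of F at p evaluated at 𝓔(p), 𝓙(p) and 𝓚(p) vanishes), and 𝓔, 𝓙, 𝓚 pairwise commute: [𝓙, 𝓔] = [𝓚, 𝓔] = [𝓙, 𝓚] = 0 (brackets over ℂ). -/
open Complex

/-- The diagonal linear vector field with eigenvalues `c`. -/
def diagField (k : ℕ) (c : Ec k) : Ec k → Ec k := fun p => c * p

theorem hasFDerivAt_diagField (k : ℕ) (c p : Ec k) :
    HasFDerivAt (𝕜 := ℂ) (diagField k c) (ContinuousLinearMap.mul ℂ (Ec k) c) p :=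
  (ContinuousLinearMap.mul ℂ (Ec k) c).hasFDerivAt

theorem lb_diagField (k : ℕ) (a b : Ec k) : lb k (diagField k a) (diagField k b) = 0 := by
  funext p
  simp only [lb, (hasFDerivAt_diagField k _ p).fderiv, ContinuousLinearMap.mul_apply', diagField,
    Pi.zero_apply]
  ring

theorem fderiv_Fdef (k : ℕ) (p v : Ec k) :
    fderiv ℝ (Fdef k) p v = (v 0).re - 2 * ∑ h : Fin k,
      (((h : ℕ) + 1) * (p 1) ^ (h : ℕ) * v 1 * (starRingEnd ℂ) (p h.succ.succ) +
        (p 1) ^ ((h : ℕ) + 1) * (starRingEnd ℂ) (v h.succ.succ)).re := by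
  have coord (m : Fin (k + 2)) : HasFDerivAt (fun q : Ec k => q m)
      (ContinuousLinearMap.proj (R := ℝ) (φ := fun _ : Fin (k + 2) => ℂ) m) p :=
    hasFDerivAt_apply m p
  have term (h : Fin k) := Complex.reCLM.hasFDerivAt.comp p
    (((coord 1).pow ((h : ℕ) + 1)).mul
      (Complex.conjCLE.toContinuousLinearMap.hasFDerivAt.comp p (coord h.succ.succ)))
  have total := (Complex.reCLM.hasFDerivAt.comp p (coord 0)).sub
    ((HasFDerivAt.fun_sum fun h (_ : h ∈ Finset.univ) => term h).const_mul 2)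
  have key : HasFDerivAt (Fdef k) _ p := total
  rw [key.fderiv]
  simp only [sub_apply, smul_apply,
    sum_apply, ContinuousLinearMap.comp_apply, add_apply,
    ContinuousLinearMap.proj_apply, Complex.reCLM_apply, smul_eq_mul]
  congr 2
  refine Finset.sum_congr rfl fun h _ => congrArg Complex.re ?_
  simp
  ring

/-- A diagonal field whose weight on every monomial of `F` is the same real number `r`
satisfies `dF(X) = r F`, and so is tangent to `M`. -/
theorem tangent_diagField (k : ℕ) (c : Ec k) (r : ℝ) (hw : c 0 = r)
    (hz : ∀ h : Fin k, ((h : ℕ) + 1) * c 1 + (starRingEnd ℂ) (c h.succ.succ) = r) :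
    Tangent k (diagField k c) := by
  intro p hp
  have hF : fderiv ℝ (Fdef k) p (diagField k c p) = r * Fdef k p := by
    rw [fderiv_Fdef, Fdef, mul_sub, mul_left_comm r, Finset.mul_sum _ _ r]
    simp only [diagField, Pi.mul_apply, hw, Complex.re_ofReal_mul, map_mul]
    congr 2
    refine Finset.sum_congr rfl fun h _ => ?_
    rw [← Complex.re_ofReal_mul, ← hz h]
    congr 1
    ring
  rw [hF, hp, mul_zero]

theorem Ef_eq_diagField (k : ℕ) : Ef k = diagField k fun m =>
    if (m : ℕ) = 0 then (k : ℂ) + 1 else if (m : ℕ) = 1 then 1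
    else ((k + 2 - (m : ℕ) : ℕ) : ℂ) := by
  funext p m
  simp only [Ef, diagField, Pi.mul_apply]
  split_ifs <;> ring

theorem Jf_eq_diagField (k : ℕ) : Jf k = diagField k fun m =>
    if (m : ℕ) = 0 then 0 else if (m : ℕ) = 1 then -I else -I * (((m : ℕ) - 1 : ℕ) : ℂ) := by
  funext p m
  simp only [Jf, diagField, Pi.mul_apply]
  split_ifs <;> ring

theorem Kf_eq_diagField (k : ℕ) : Kf k = diagField k fun m =>
    if (m : ℕ) = 0 then 0 else if (m : ℕ) = 1 then -1 else (((m : ℕ) - 1 : ℕ) : ℂ) := by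
  funext p m
  simp only [Kf, diagField, Pi.mul_apply]
  split_ifs <;> ring

theorem tangent_Ef (k : ℕ) : Tangent k (Ef k) := by
  rw [Ef_eq_diagField]
  refine tangent_diagField k _ (k + 1) (by simp) fun h => ?_
  have hh : (h : ℕ) ≤ k := h.isLt.le
  simp [Nat.cast_sub hh]
  ring

theorem tangent_Jf (k : ℕ) : Tangent k (Jf k) := by
  rw [Jf_eq_diagField]
  refine tangent_diagField k _ 0 (by simp) fun h => ?_
  simp
  ring

theorem tangent_Kf (k : ℕ) : Tangent k (Kf k) := by
  rw [Kf_eq_diagField]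
  refine tangent_diagField k _ 0 (by simp) fun h => ?_
  simp

/-- The real parts of `𝓔, 𝓙, 𝓚` are tangent to `M`, and `𝓔, 𝓙, 𝓚` pairwise commute. -/
theorem stmt11 (k : ℕ) (hk : 1 ≤ k) :
    Tangent k (Ef k) ∧ Tangent k (Jf k) ∧ Tangent k (Kf k) ∧
    lb k (Jf k) (Ef k) = 0 ∧ lb k (Kf k) (Ef k) = 0 ∧ lb k (Jf k) (Kf k) = 0 := by
  refine ⟨tangent_Ef k, tangent_Jf k, tangent_Kf k, ?_, ?_, ?_⟩ <;>
    simp only [Ef_eq_diagField, Jf_eq_diagField, Kf_eq_diagField, lb_diagField]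
end

section
/- The vector field 𝓙 acts as an infinitesimal rotation on the W-family: for 1 ≤ h ≤ k, [𝓙, Z_h] = h·Z'_h and [𝓙, Z'_h] = −h·Z_h; [𝓙, W] = 0; for 1 ≤ h < j ≤ k, [𝓙, A_{h,j}] = (h−j)·A'_{h,j} and [𝓙, A'_{h,j}] = −(h−j)·A_{h,j}; and [𝓙, A'_h] = 0 for 1 ≤ h ≤ k (all brackets over ℂ). -/
open Complex

/-- The weight of the coordinate of index `m` under `𝓙`. -/
def rotWeight (m : ℕ) : ℂ := if m = 0 then 0 else if m = 1 then 1 else ((m - 1 : ℕ) : ℂ)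

lemma Jf_apply (k : ℕ) (p : Ec k) (m : Fin (k + 2)) :
    Jf k p m = -I * rotWeight m * p m := by
  unfold Jf rotWeight
  split_ifs <;> simp

/-- `𝓙` acts diagonally on vector fields whose components are monomials in `z₀`. -/
lemma lb_Jf_of_monomial {k : ℕ} {X : Ec k → Ec k} (c : Fin (k + 2) → ℂ) (n : Fin (k + 2) → ℕ)
    (hX : ∀ p m, X p m = c m * p 1 ^ n m) (p : Ec k) (m : Fin (k + 2)) :
    lb k (Jf k) X p m = -I * ((n m : ℂ) - rotWeight m) * X p m := by
  have hJ : HasFDerivAt (Jf k) (ContinuousLinearMap.pi fun m : Fin (k + 2) =>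
      (-I * rotWeight m) • ContinuousLinearMap.proj (R := ℂ) (φ := fun _ => ℂ) m) p := by
    rw [hasFDerivAt_pi']
    intro i
    have h : (fun q : Ec k => Jf k q i) = fun q => (-I * rotWeight i) * q i :=
      funext fun q => Jf_apply k q i
    rw [h]
    exact (hasFDerivAt_apply i p).const_mul _
  have hX' : HasFDerivAt X (ContinuousLinearMap.pi fun m : Fin (k + 2) =>
      c m • ((n m * p 1 ^ (n m - 1) : ℂ) •
        ContinuousLinearMap.proj (R := ℂ) (φ := fun _ => ℂ) (1 : Fin (k + 2)))) p := by
    rw [hasFDerivAt_pi']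
    intro i
    have h : (fun q : Ec k => X q i) = fun q => c i * q 1 ^ n i := funext fun q => hX q i
    rw [h]
    exact ((hasDerivAt_pow (n i) (p 1)).comp_hasFDerivAt p
      (hasFDerivAt_apply (1 : Fin (k + 2)) p)).const_mul _
  have hJ1 : Jf k p 1 = -I * p 1 := by simp [Jf]
  have hpow : (n m : ℂ) * p 1 ^ (n m - 1) * p 1 = n m * p 1 ^ n m := by
    rcases n m with _ | a
    · simp
    · simp [pow_succ, mul_assoc]
  simp only [lb, hX'.fderiv, hJ.fderiv, Pi.sub_apply, ContinuousLinearMap.coe_pi',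
    smul_apply, ContinuousLinearMap.proj_apply, smul_eq_mul, hJ1, hX]
  linear_combination (-I * c m) * hpow

lemma rotWeight_succ {h : ℕ} (hh : 1 ≤ h) : rotWeight (h + 1) = h := by
  obtain ⟨a, rfl⟩ := Nat.exists_eq_add_of_le' hh
  simp [rotWeight]

lemma lb_Jf_Zf {k h : ℕ} (hh : 1 ≤ h) : lb k (Jf k) (Zf k h) = (h : ℂ) • Zf' k h := by
  ext p m
  rw [lb_Jf_of_monomial (fun m => if (m : ℕ) = 0 then 1 else if (m : ℕ) = h + 1 then 1 / 2 else 0)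
    (fun m => if (m : ℕ) = 0 then h else 0) (by intro p m; unfold Zf; split_ifs <;> simp)]
  simp only [Pi.smul_apply, smul_eq_mul, Zf, Zf']
  split_ifs with h0 h1
  · simp only [h0, rotWeight, if_true]; ring
  · rw [h1, rotWeight_succ hh]; push_cast; ring
  · simp

lemma lb_Jf_Zf' {k h : ℕ} (hh : 1 ≤ h) : lb k (Jf k) (Zf' k h) = (-(h : ℂ)) • Zf k h := by
  ext p m
  rw [lb_Jf_of_monomial
    (fun m => if (m : ℕ) = 0 then -I else if (m : ℕ) = h + 1 then I / 2 else 0)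
    (fun m => if (m : ℕ) = 0 then h else 0) (by intro p m; unfold Zf'; split_ifs <;> simp)]
  simp only [Pi.smul_apply, smul_eq_mul, Zf, Zf']
  split_ifs with h0 h1
  · simp only [h0, rotWeight, if_true]; linear_combination (h * p 1 ^ h) * I_sq
  · rw [h1, rotWeight_succ hh]; push_cast; linear_combination (h / 2 : ℂ) * I_sq
  · simp

lemma lb_Jf_Wf (k : ℕ) : lb k (Jf k) (Wf k) = 0 := by
  ext p m
  rw [lb_Jf_of_monomial (fun m => if (m : ℕ) = 0 then I else 0) (fun _ => 0)
    (by intro p m; simp [Wf])]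
  by_cases h0 : (m : ℕ) = 0 <;> simp [Wf, rotWeight, h0]

lemma lb_Jf_Af {k h j : ℕ} (hh : 1 ≤ h) (hj : 1 ≤ j) :
    lb k (Jf k) (Af k h j) = ((h : ℂ) - (j : ℂ)) • Af' k h j := by
  ext p m
  rw [lb_Jf_of_monomial
    (fun m => if (m : ℕ) = j + 1 then 1 / 2 else if (m : ℕ) = h + 1 then -(1 / 2) else 0)
    (fun m => if (m : ℕ) = j + 1 then h else j) (by intro p m; unfold Af; split_ifs <;> simp)]
  simp only [Pi.smul_apply, smul_eq_mul, Af, Af']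
  split_ifs with h0 h1
  · rw [h0, rotWeight_succ hj]; ring
  · rw [h1, rotWeight_succ hh]; ring
  · simp

lemma lb_Jf_Af' {k h j : ℕ} (hh : 1 ≤ h) (hj : 1 ≤ j) :
    lb k (Jf k) (Af' k h j) = (-((h : ℂ) - (j : ℂ))) • Af k h j := by
  ext p m
  rw [lb_Jf_of_monomial
    (fun m => if (m : ℕ) = j + 1 then -(I / 2) else if (m : ℕ) = h + 1 then -(I / 2) else 0)
    (fun m => if (m : ℕ) = j + 1 then h else j) (by intro p m; unfold Af'; split_ifs <;> simp)]
  simp only [Pi.smul_apply, smul_eq_mul, Af, Af']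
  split_ifs with h0 h1
  · rw [h0, rotWeight_succ hj]
    linear_combination ((h - j) / 2 * p 1 ^ h : ℂ) * I_sq
  · rw [h1, rotWeight_succ hh]
    linear_combination ((j - h) / 2 * p 1 ^ j : ℂ) * I_sq
  · simp

lemma lb_Jf_Ahf {k h : ℕ} (hh : 1 ≤ h) : lb k (Jf k) (Ahf k h) = 0 := by
  ext p m
  rw [lb_Jf_of_monomial (fun m => if (m : ℕ) = h + 1 then I else 0) (fun _ => h)
    (by intro p m; simp [Ahf])]
  by_cases h0 : (m : ℕ) = h + 1
  · simp [h0, rotWeight_succ hh]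
  · simp [Ahf, h0]

/-- `𝓙` acts as an infinitesimal rotation on the `W`-family. -/
theorem stmt12 (k : ℕ) (hk : 1 ≤ k) :
    (∀ h : ℕ, 1 ≤ h → h ≤ k →
      lb k (Jf k) (Zf k h) = (h : ℂ) • Zf' k h ∧
      lb k (Jf k) (Zf' k h) = (-(h : ℂ)) • Zf k h) ∧
    lb k (Jf k) (Wf k) = 0 ∧
    (∀ h j : ℕ, 1 ≤ h → h < j → j ≤ k →
      lb k (Jf k) (Af k h j) = ((h : ℂ) - (j : ℂ)) • Af' k h j ∧
      lb k (Jf k) (Af' k h j) = (-((h : ℂ) - (j : ℂ))) • Af k h j) ∧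
    (∀ h : ℕ, 1 ≤ h → h ≤ k → lb k (Jf k) (Ahf k h) = 0) := by
  exact ⟨fun h hh _ => ⟨lb_Jf_Zf hh, lb_Jf_Zf' hh⟩, lb_Jf_Wf k,
    fun h j hh hj _ => ⟨lb_Jf_Af hh (hh.trans hj.le), lb_Jf_Af' hh (hh.trans hj.le)⟩,
    fun h hh _ => lb_Jf_Ahf hh⟩
end

section
/- The vector field 𝓚 + 𝓔 acts as −(k+1) times the identity on the W-family: for every vector field X in the W-family (i.e. among Z_h, Z'_h, W, A_{h,j}, A'_{h,j}, A'_h), one has [𝓚 + 𝓔, X] = −(k+1)·X (bracket over ℂ). -/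
open Complex

/-- `𝓚 + 𝓔` is the linear field `(k+1)·p` with its `z₀`-component removed. -/
theorem Kf_add_Ef_apply (k : ℕ) (p : Ec k) (m : Fin (k + 2)) :
    (Kf k + Ef k) p m = if m = 1 then 0 else ((k : ℂ) + 1) * p m := by
  have hm := m.isLt
  have h1 : m = 1 ↔ (m : ℕ) = 1 := by simp [Fin.ext_iff]
  simp only [Pi.add_apply, Kf, Ef, h1]
  split_ifs with h
  · omega
  · ring
  · ring
  · rw [← add_mul, ← Nat.cast_add, show (m : ℕ) - 1 + (k + 2 - m) = k + 1 by omega]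
    push_cast
    rfl

theorem hasFDerivAt_Kf_add_Ef (k : ℕ) (p : Ec k) :
    ∃ L : Ec k →L[ℂ] Ec k, (∀ v, L v = (Kf k + Ef k) v) ∧ HasFDerivAt (Kf k + Ef k) L p := by
  let L : Ec k →L[ℂ] Ec k := ContinuousLinearMap.pi fun m =>
    (if m = 1 then (0 : ℂ) else (k : ℂ) + 1) • ContinuousLinearMap.proj m
  have hL : ⇑L = Kf k + Ef k := by
    funext v m
    rw [Kf_add_Ef_apply]
    simp only [L, ContinuousLinearMap.coe_pi']
    split_ifs <;> simp
  exact ⟨L, fun v => congrFun hL v, hL ▸ L.hasFDerivAt⟩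

/-- A vector field that depends on `z₀` only and has no `z₀`-component is an eigenvector
of `ad (𝓚 + 𝓔)`. -/
theorem lb_Kf_add_Ef_comp (k : ℕ) (f : ℂ → Ec k) (hf : Differentiable ℂ f)
    (hf1 : ∀ z, f z 1 = 0) :
    lb k (Kf k + Ef k) (fun p => f (p 1)) = (-((k : ℂ) + 1)) • fun p => f (p 1) := by
  funext p
  obtain ⟨L, hLv, hL⟩ := hasFDerivAt_Kf_add_Ef k p
  have hX : HasFDerivAt (fun q : Ec k => f (q 1))
      ((fderiv ℂ f (p 1)).comp (ContinuousLinearMap.proj (R := ℂ) (φ := fun _ => ℂ) 1)) p :=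
    (hf (p 1)).hasFDerivAt.comp p (hasFDerivAt_apply 1 p)
  have hV : (Kf k + Ef k) p 1 = 0 := by rw [Kf_add_Ef_apply, if_pos rfl]
  funext m
  rw [lb, hX.fderiv, hL.fderiv, hLv, ContinuousLinearMap.comp_apply,
    ContinuousLinearMap.proj_apply, hV, map_zero, zero_sub, Pi.neg_apply, Kf_add_Ef_apply]
  split_ifs with h
  · simp [h, hf1]
  · exact (neg_mul _ _).symm

/-- `𝓚 + 𝓔` acts as `-(k+1)·id` on the `W`-family. -/
theorem stmt13 (k : ℕ) (hk : 1 ≤ k) :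
    ∀ X ∈ WFamily k, lb k (Kf k + Ef k) X = (-((k : ℂ) + 1)) • X := by
  rintro X (⟨h, h1, -, rfl⟩ | ⟨h, h1, -, rfl⟩ | rfl | ⟨h, j, h1, hj, -, rfl⟩ |
    ⟨h, j, h1, hj, -, rfl⟩ | ⟨h, h1, -, rfl⟩)
  · refine lb_Kf_add_Ef_comp k (fun z m =>
      if (m : ℕ) = 0 then z ^ h else if (m : ℕ) = h + 1 then 1 / 2 else 0) ?_ ?_
    · refine differentiable_pi.2 fun m => ?_
      split_ifs <;> fun_prop
    · intro z
      simp [show h ≠ 0 by omega]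
  · refine lb_Kf_add_Ef_comp k (fun z m =>
      if (m : ℕ) = 0 then -I * z ^ h else if (m : ℕ) = h + 1 then I / 2 else 0) ?_ ?_
    · refine differentiable_pi.2 fun m => ?_
      split_ifs <;> fun_prop
    · intro z
      simp [show h ≠ 0 by omega]
  · refine lb_Kf_add_Ef_comp k (fun _ m => if (m : ℕ) = 0 then I else 0) (by fun_prop) ?_
    intro z
    simp
  · refine lb_Kf_add_Ef_comp k (fun z m =>
      if (m : ℕ) = j + 1 then (1 / 2) * z ^ h
      else if (m : ℕ) = h + 1 then -(1 / 2) * z ^ j else 0) ?_ ?_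
    · refine differentiable_pi.2 fun m => ?_
      split_ifs <;> fun_prop
    · intro z
      simp [show h ≠ 0 by omega, show j ≠ 0 by omega]
  · refine lb_Kf_add_Ef_comp k (fun z m =>
      if (m : ℕ) = j + 1 then -(I / 2) * z ^ h
      else if (m : ℕ) = h + 1 then -(I / 2) * z ^ j else 0) ?_ ?_
    · refine differentiable_pi.2 fun m => ?_
      split_ifs <;> fun_prop
    · intro z
      simp [show h ≠ 0 by omega, show j ≠ 0 by omega]
  · refine lb_Kf_add_Ef_comp k (fun z m =>
      if (m : ℕ) = h + 1 then I * z ^ h else 0) ?_ ?_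
    · refine differentiable_pi.2 fun m => ?_
      split_ifs <;> fun_prop
    · intro z
      simp [show h ≠ 0 by omega]
end

section
/- The ascending and descending fields satisfy: [Z₋, Z'₋] = 0 and [Z₊, Z'₊] = 0; [𝓙, Z₋] = Z'₋, [𝓙, Z'₋] = −Z₋, [𝓙, Z₊] = Z'₊, [𝓙, Z'₊] = −Z₊; and [𝓚 + 𝓔, Z₊] = [𝓚 + 𝓔, Z₋] = [𝓚 + 𝓔, Z'₊] = [𝓚 + 𝓔, Z'₋] = 0 (all brackets over ℂ). -/
open Complex

lemma fderiv_apply_coord {k : ℕ} {X : Ec k → Ec k}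
    (hX : ∀ m, Differentiable ℂ fun q => X q m) (p v : Ec k) (m : Fin (k + 2)) :
    fderiv ℂ X p v m = fderiv ℂ (fun q => X q m) p v := by
  rw [show X = fun q m => X q m from rfl, fderiv_pi fun m => hX m p]
  rfl

lemma fderiv_coord {k : ℕ} (i : Fin (k + 2)) (p : Ec k) :
    fderiv ℂ (fun q : Ec k => q i) p = ContinuousLinearMap.proj i :=
  (hasFDerivAt_apply i p).fderiv

lemma differentiable_Zmf (k : ℕ) (m : Fin (k + 2)) : Differentiable ℂ fun q => Zmf k q m := by
  unfold Zmf; split_ifs <;> fun_prop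

lemma differentiable_Zmf' (k : ℕ) (m : Fin (k + 2)) : Differentiable ℂ fun q => Zmf' k q m := by
  unfold Zmf'; split_ifs <;> fun_prop

lemma differentiable_Zpf (k : ℕ) (m : Fin (k + 2)) : Differentiable ℂ fun q => Zpf k q m := by
  unfold Zpf; split_ifs <;> fun_prop

lemma differentiable_Zpf' (k : ℕ) (m : Fin (k + 2)) : Differentiable ℂ fun q => Zpf' k q m := by
  unfold Zpf'; split_ifs <;> fun_prop

lemma fderiv_Zmf (k : ℕ) (p v : Ec k) (m : Fin (k + 2)) :
    fderiv ℂ (Zmf k) p v m = if (m : ℕ) = 1 then 0 else Zmf k v m := by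
  rw [fderiv_apply_coord (differentiable_Zmf k)]
  unfold Zmf
  split_ifs <;> first
    | omega
    | simp (disch := fun_prop) [fderiv_const_mul, fderiv_coord]

lemma fderiv_Zmf' (k : ℕ) (p v : Ec k) (m : Fin (k + 2)) :
    fderiv ℂ (Zmf' k) p v m = if (m : ℕ) = 1 then 0 else Zmf' k v m := by
  rw [fderiv_apply_coord (differentiable_Zmf' k)]
  unfold Zmf'
  split_ifs <;> first
    | omega
    | simp (disch := fun_prop) [fderiv_const_mul, fderiv_coord]

lemma fderiv_Zpf (k : ℕ) (p v : Ec k) (m : Fin (k + 2)) :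
    fderiv ℂ (Zpf k) p v m =
      if (m : ℕ) = 0 then p 1 * v 0 + v 1 * p 0
      else if (m : ℕ) = 1 then 2 * p 1 * v 1 / (k : ℂ)
      else if (m : ℕ) = 2 then p 2 * v 1 + v 2 * p 1 - v 0 / 2
      else p m * v 1 + v m * p 1 +
        (1 - (((m : ℕ) - 2 : ℕ) : ℂ) / (k : ℂ)) * v ⟨(m : ℕ) - 1, by omega⟩ := by
  rw [fderiv_apply_coord (differentiable_Zpf k)]
  unfold Zpf
  split_ifs <;>
    simp (disch := fun_prop) [div_eq_mul_inv, fderiv_fun_add, fderiv_fun_sub, fderiv_fun_mul,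
      fderiv_fun_pow, fderiv_coord] <;> ring

lemma fderiv_Zpf' (k : ℕ) (p v : Ec k) (m : Fin (k + 2)) :
    fderiv ℂ (Zpf' k) p v m =
      if (m : ℕ) = 0 then -I * (p 1 * v 0 + v 1 * p 0)
      else if (m : ℕ) = 1 then -I * (2 * p 1 * v 1 / (k : ℂ))
      else if (m : ℕ) = 2 then -I * (p 2 * v 1 + v 2 * p 1) - I / 2 * v 0
      else -I * (p m * v 1 + v m * p 1) +
        I * (1 - (((m : ℕ) - 2 : ℕ) : ℂ) / (k : ℂ)) * v ⟨(m : ℕ) - 1, by omega⟩ := by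
  rw [fderiv_apply_coord (differentiable_Zpf' k)]
  unfold Zpf'
  split_ifs <;>
    simp (disch := fun_prop) [div_eq_mul_inv, fderiv_fun_add, fderiv_fun_sub, fderiv_fun_mul,
      fderiv_fun_pow, fderiv_coord] <;> ring

/-- The weights of `𝓙`, as a diagonal linear field. -/
def weightJ (m : ℕ) : ℂ :=
  if m = 0 then 0 else if m = 1 then -I else -I * ((m : ℂ) - 1)

/-- The weights of `𝓚 + 𝓔`, as a diagonal linear field. -/
def weightKE (k m : ℕ) : ℂ := if m = 1 then 0 else (k : ℂ) + 1

lemma Jf_eq (k : ℕ) : Jf k = fun (p : Ec k) (m : Fin (k + 2)) => weightJ m * p m := by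
  funext p m
  unfold Jf weightJ
  split_ifs with h0 h1
  · simp
  · rfl
  · rw [Nat.cast_sub (by omega), Nat.cast_one]

lemma Kf_add_Ef_eq (k : ℕ) :
    Kf k + Ef k = fun (p : Ec k) (m : Fin (k + 2)) => weightKE k m * p m := by
  funext p m
  simp only [Pi.add_apply]
  unfold Kf Ef weightKE
  split_ifs with h0 h1
  · omega
  · simp
  · simp
  · rw [Nat.cast_sub (by omega), Nat.cast_sub (by omega)]
    push_cast
    ring

lemma lb_diagonal {k : ℕ} (a : ℕ → ℂ) (Y : Ec k → Ec k) (p : Ec k) (m : Fin (k + 2)) :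
    lb k (fun (p : Ec k) (m : Fin (k + 2)) => a m * p m) Y p m =
      fderiv ℂ Y p (fun m => a m * p m) m - a m * Y p m := by
  have h : fderiv ℂ (fun (p : Ec k) (m : Fin (k + 2)) => a m * p m) p (Y p) m = a m * Y p m := by
    rw [fderiv_apply_coord (fun m => by fun_prop)]
    simp (disch := fun_prop) [fderiv_const_mul, fderiv_coord]
  simp only [lb, Pi.sub_apply, h]

lemma val_two_of_pos {k : ℕ} (hk : 1 ≤ k) : ((2 : Fin (k + 2)) : ℕ) = 2 :=
  Nat.mod_eq_of_lt (show 2 < k + 2 by omega)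

lemma lb_Zmf_Zmf' {k : ℕ} (hk : 1 ≤ k) : lb k (Zmf k) (Zmf' k) = 0 := by
  have h2 := val_two_of_pos hk
  funext p m
  simp only [lb, Pi.sub_apply, Pi.zero_apply, fderiv_Zmf, fderiv_Zmf']
  simp only [Zmf, Zmf', h2]
  split_ifs <;> first
    | contradiction
    | omega
    | (push_cast; ring1)

lemma lb_Zpf_Zpf' {k : ℕ} (hk : 1 ≤ k) : lb k (Zpf k) (Zpf' k) = 0 := by
  have h2 := val_two_of_pos hk
  funext p m
  have e : (m : ℕ) - 1 = 2 → p ⟨(m : ℕ) - 1, by omega⟩ = p 2 := fun h =>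
    congrArg p (Fin.ext (h.trans h2.symm))
  simp only [lb, Pi.sub_apply, Pi.zero_apply, fderiv_Zpf, fderiv_Zpf']
  simp only [Zpf, Zpf', h2, Fin.val_zero, Fin.val_one]
  split_ifs <;> first
    | contradiction
    | omega
    | ring1
    | (rw [e (by assumption)]; ring1)

lemma lb_diagonal_Zmf {k : ℕ} (hk : 1 ≤ k) (a : ℕ → ℂ) (p : Ec k) (m : Fin (k + 2)) :
    lb k (fun (p : Ec k) (m : Fin (k + 2)) => a m * p m) (Zmf k) p m =
      (if (m : ℕ) = 0 then a 2 else if (m : ℕ) = 1 then 0 else a (m + 1)) * Zmf k p m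
        - a m * Zmf k p m := by
  rw [lb_diagonal, fderiv_Zmf]
  simp only [Zmf, val_two_of_pos hk]
  split_ifs <;> first
    | contradiction
    | omega
    | ring1

lemma lb_diagonal_Zmf' {k : ℕ} (hk : 1 ≤ k) (a : ℕ → ℂ) (p : Ec k) (m : Fin (k + 2)) :
    lb k (fun (p : Ec k) (m : Fin (k + 2)) => a m * p m) (Zmf' k) p m =
      (if (m : ℕ) = 0 then a 2 else if (m : ℕ) = 1 then 0 else a (m + 1)) * Zmf' k p m
        - a m * Zmf' k p m := by
  rw [lb_diagonal, fderiv_Zmf']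
  simp only [Zmf', val_two_of_pos hk]
  split_ifs <;> first
    | contradiction
    | omega
    | ring1

lemma lb_Jf_Zmf {k : ℕ} (hk : 1 ≤ k) : lb k (Jf k) (Zmf k) = Zmf' k := by
  funext p m
  rw [Jf_eq, lb_diagonal_Zmf hk]
  simp only [Zmf, Zmf', weightJ]
  split_ifs <;> first
    | contradiction
    | omega
    | (push_cast; ring1)

lemma lb_Jf_Zmf' {k : ℕ} (hk : 1 ≤ k) : lb k (Jf k) (Zmf' k) = -Zmf k := by
  funext p m
  rw [Jf_eq, lb_diagonal_Zmf' hk]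
  simp only [Zmf, Zmf', weightJ, Pi.neg_apply]
  split_ifs <;> first
    | contradiction
    | omega
    | ring1
    | (push_cast; ring_nf; simp only [I_sq]; ring1)

lemma lb_Jf_Zpf {k : ℕ} (hk : 1 ≤ k) : lb k (Jf k) (Zpf k) = Zpf' k := by
  funext p m
  rw [Jf_eq, lb_diagonal, fderiv_Zpf]
  simp only [Zpf, Zpf', weightJ, val_two_of_pos hk, Fin.val_zero, Fin.val_one]
  split_ifs <;> first
    | contradiction
    | omega
    | (simp only [‹(m : ℕ) = 2›]; push_cast; ring1)
    | (push_cast [Nat.cast_sub (show 1 ≤ (m : ℕ) by omega)]; ring1)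
    | ring1

lemma lb_Jf_Zpf' {k : ℕ} (hk : 1 ≤ k) : lb k (Jf k) (Zpf' k) = -Zpf k := by
  funext p m
  rw [Jf_eq, lb_diagonal, fderiv_Zpf']
  simp only [Zpf, Zpf', weightJ, val_two_of_pos hk, Fin.val_zero, Fin.val_one, Pi.neg_apply]
  split_ifs <;> first
    | contradiction
    | omega
    | (simp only [‹(m : ℕ) = 2›]; push_cast; ring_nf; simp only [I_sq]; ring1)
    | (push_cast [Nat.cast_sub (show 1 ≤ (m : ℕ) by omega)]; ring_nf; simp only [I_sq]; ring1)
    | (ring_nf; simp only [I_sq]; ring1)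

lemma lb_Kf_add_Ef_Zpf {k : ℕ} (hk : 1 ≤ k) : lb k (Kf k + Ef k) (Zpf k) = 0 := by
  funext p m
  rw [Kf_add_Ef_eq, lb_diagonal, fderiv_Zpf]
  simp only [Zpf, weightKE, val_two_of_pos hk, Fin.val_zero, Fin.val_one, Pi.zero_apply]
  split_ifs <;> first
    | contradiction
    | omega
    | ring1

lemma lb_Kf_add_Ef_Zpf' {k : ℕ} (hk : 1 ≤ k) : lb k (Kf k + Ef k) (Zpf' k) = 0 := by
  funext p m
  rw [Kf_add_Ef_eq, lb_diagonal, fderiv_Zpf']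
  simp only [Zpf', weightKE, val_two_of_pos hk, Fin.val_zero, Fin.val_one, Pi.zero_apply]
  split_ifs <;> first
    | contradiction
    | omega
    | ring1

lemma lb_Kf_add_Ef_Zmf {k : ℕ} (hk : 1 ≤ k) : lb k (Kf k + Ef k) (Zmf k) = 0 := by
  funext p m
  rw [Kf_add_Ef_eq, lb_diagonal_Zmf hk]
  simp only [weightKE, Pi.zero_apply]
  split_ifs <;> first
    | contradiction
    | omega
    | ring1

lemma lb_Kf_add_Ef_Zmf' {k : ℕ} (hk : 1 ≤ k) : lb k (Kf k + Ef k) (Zmf' k) = 0 := by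
  funext p m
  rw [Kf_add_Ef_eq, lb_diagonal_Zmf' hk]
  simp only [weightKE, Pi.zero_apply]
  split_ifs <;> first
    | contradiction
    | omega
    | ring1

/-- Commutation relations of the ascending and descending fields with `𝓙` and `𝓚 + 𝓔`. -/
theorem stmt15 (k : ℕ) (hk : 1 ≤ k) :
    lb k (Zmf k) (Zmf' k) = 0 ∧ lb k (Zpf k) (Zpf' k) = 0 ∧
    lb k (Jf k) (Zmf k) = Zmf' k ∧ lb k (Jf k) (Zmf' k) = -Zmf k ∧
    lb k (Jf k) (Zpf k) = Zpf' k ∧ lb k (Jf k) (Zpf' k) = -Zpf k ∧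
    lb k (Kf k + Ef k) (Zpf k) = 0 ∧ lb k (Kf k + Ef k) (Zmf k) = 0 ∧
    lb k (Kf k + Ef k) (Zpf' k) = 0 ∧ lb k (Kf k + Ef k) (Zmf' k) = 0 := by
  exact ⟨lb_Zmf_Zmf' hk, lb_Zpf_Zpf' hk, lb_Jf_Zmf hk, lb_Jf_Zmf' hk, lb_Jf_Zpf hk, lb_Jf_Zpf' hk,
    lb_Kf_add_Ef_Zpf hk, lb_Kf_add_Ef_Zmf hk, lb_Kf_add_Ef_Zpf' hk, lb_Kf_add_Ef_Zmf' hk⟩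
end

section
/- The vector field 𝓗 grades the W-family: for 1 ≤ h ≤ k, [𝓗, Z_h] = −2(k−h)·Z_h and [𝓗, Z'_h] = −2(k−h)·Z'_h; [𝓗, W] = −2k·W; for 1 ≤ h < j ≤ k, [𝓗, A_{h,j}] = 2((h+j)−k)·A_{h,j} and [𝓗, A'_{h,j}] = 2((h+j)−k)·A'_{h,j}; and [𝓗, A'_h] = 2(2h−k)·A'_h for 1 ≤ h ≤ k (all brackets over ℂ). -/
open Complex

/-- The weight of the coordinate with index `m` under the diagonal vector field `Hf k`. -/
noncomputable def Hweight (k m : ℕ) : ℂ :=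
  if m = 0 then 2 * k else if m = 1 then 2 else (2 * (k + 1 - m) : ℕ)

theorem Hweight_succ {k h : ℕ} (h1 : 1 ≤ h) (hk : h ≤ k) :
    Hweight k (h + 1) = 2 * (k - h) := by
  simp [Hweight, show h ≠ 0 by omega, Nat.cast_sub hk]

theorem Hf_apply (k : ℕ) (p : Ec k) (m : Fin (k + 2)) : Hf k p m = Hweight k m * p m := by
  unfold Hf Hweight
  split_ifs <;> rfl

theorem hasFDerivAt_Hf (k : ℕ) (p : Ec k) :
    HasFDerivAt (𝕜 := ℂ) (Hf k)
      (.pi fun m => Hweight k m • ContinuousLinearMap.proj (R := ℂ) (φ := fun _ => ℂ) m) p := by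
  rw [hasFDerivAt_pi']
  intro m
  simp only [Hf_apply]
  exact (hasFDerivAt_apply m p).const_mul _

/-- A vector field whose components are monomials in `z₀` is an eigenvector of `[Hf k, ·]` as soon
as all its nonzero components have the same weight. -/
theorem lb_Hf_eq_smul {k : ℕ} {X : Ec k → Ec k} (c : Fin (k + 2) → ℂ) (e : Fin (k + 2) → ℕ)
    (hX : ∀ p m, X p m = c m * p 1 ^ e m) {μ : ℂ}
    (hμ : ∀ m, c m ≠ 0 → 2 * (e m : ℂ) - Hweight k m = μ) :
    lb k (Hf k) X = μ • X := by
  funext p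
  have hD : HasFDerivAt (𝕜 := ℂ) X
      (.pi fun m => c m • ((e m * p 1 ^ (e m - 1)) •
        ContinuousLinearMap.proj (R := ℂ) (φ := fun _ => ℂ) 1)) p := by
    rw [hasFDerivAt_pi']
    intro m
    simp only [hX]
    exact (((hasDerivAt_pow (e m) (p 1)).comp_hasFDerivAt p
      (hasFDerivAt_apply (1 : Fin (k + 2)) p))).const_mul _
  ext m
  have h1 : Hf k p 1 = 2 * p 1 := by simp [Hf]
  simp only [lb, hD.fderiv, (hasFDerivAt_Hf k p).fderiv, Pi.sub_apply, Pi.smul_apply,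
    ContinuousLinearMap.coe_pi', smul_apply, ContinuousLinearMap.proj_apply,
    smul_eq_mul, h1, hX]
  by_cases hc : c m = 0
  · simp [hc]
  rw [← hμ m hc]
  rcases e m with _ | n
  · simp
  · simp only [Nat.add_sub_cancel, pow_succ]
    ring


/-- `𝓗` grades the `W`-family. -/
theorem stmt17 (k : ℕ) (hk : 1 ≤ k) :
    (∀ h : ℕ, 1 ≤ h → h ≤ k →
      lb k (Hf k) (Zf k h) = (-2 * ((k : ℂ) - (h : ℂ))) • Zf k h ∧
      lb k (Hf k) (Zf' k h) = (-2 * ((k : ℂ) - (h : ℂ))) • Zf' k h) ∧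
    lb k (Hf k) (Wf k) = (-2 * (k : ℂ)) • Wf k ∧
    (∀ h j : ℕ, 1 ≤ h → h < j → j ≤ k →
      lb k (Hf k) (Af k h j) = (2 * (((h : ℂ) + (j : ℂ)) - (k : ℂ))) • Af k h j ∧
      lb k (Hf k) (Af' k h j) = (2 * (((h : ℂ) + (j : ℂ)) - (k : ℂ))) • Af' k h j) ∧
    (∀ h : ℕ, 1 ≤ h → h ≤ k →
      lb k (Hf k) (Ahf k h) = (2 * (2 * (h : ℂ) - (k : ℂ))) • Ahf k h) := by
  refine ⟨fun h h1 hk' => ⟨?_, ?_⟩, ?_, fun h j h1 hj hk' => ⟨?_, ?_⟩, fun h h1 hk' => ?_⟩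
  · refine lb_Hf_eq_smul
      (fun m => if (m : ℕ) = 0 then 1 else if (m : ℕ) = h + 1 then 1 / 2 else 0)
      (fun m => if (m : ℕ) = 0 then h else 0) (fun p m => ?_) (fun m hm => ?_)
    · simp only [Zf]; split_ifs <;> simp
    · split_ifs at hm ⊢ with h0 hh
      · simp [h0, Hweight]; ring
      · rw [hh, Hweight_succ h1 hk']; push_cast; ring
      · exact absurd rfl hm
  · refine lb_Hf_eq_smul
      (fun m => if (m : ℕ) = 0 then -I else if (m : ℕ) = h + 1 then I / 2 else 0)
      (fun m => if (m : ℕ) = 0 then h else 0) (fun p m => ?_) (fun m hm => ?_)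
    · simp only [Zf']; split_ifs <;> simp
    · split_ifs at hm ⊢ with h0 hh
      · simp [h0, Hweight]; ring
      · rw [hh, Hweight_succ h1 hk']; push_cast; ring
      · exact absurd rfl hm
  · refine lb_Hf_eq_smul (fun m => if (m : ℕ) = 0 then I else 0) (fun _ => 0)
      (fun p m => ?_) (fun m hm => ?_)
    · simp [Wf]
    · split_ifs at hm with h0
      · simp [h0, Hweight]
      · exact absurd rfl hm
  · refine lb_Hf_eq_smul
      (fun m => if (m : ℕ) = j + 1 then 1 / 2 else if (m : ℕ) = h + 1 then -(1 / 2) else 0)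
      (fun m => if (m : ℕ) = j + 1 then h else j) (fun p m => ?_) (fun m hm => ?_)
    · simp only [Af]; split_ifs <;> simp
    · split_ifs at hm ⊢ with hj' hh
      · rw [hj', Hweight_succ (h1.trans hj.le) hk']; ring
      · rw [hh, Hweight_succ h1 (hj.le.trans hk')]; ring
      · exact absurd rfl hm
  · refine lb_Hf_eq_smul
      (fun m => if (m : ℕ) = j + 1 then -(I / 2) else if (m : ℕ) = h + 1 then -(I / 2) else 0)
      (fun m => if (m : ℕ) = j + 1 then h else j) (fun p m => ?_) (fun m hm => ?_)
    · simp only [Af']; split_ifs <;> simp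
    · split_ifs at hm ⊢ with hj' hh
      · rw [hj', Hweight_succ (h1.trans hj.le) hk']; ring
      · rw [hh, Hweight_succ h1 (hj.le.trans hk')]; ring
      · exact absurd rfl hm
  · refine lb_Hf_eq_smul (fun m => if (m : ℕ) = h + 1 then I else 0) (fun _ => h)
      (fun p m => ?_) (fun m hm => ?_)
    · simp [Ahf]
    · split_ifs at hm with hh
      · rw [hh, Hweight_succ h1 hk']; ring
      · exact absurd rfl hm
end
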